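/- Assume k₁/ρ₁ = k₂/ρ₂ and k₁ ≠ k₃. Then there exist NO data as in the resolvent-sequence setting with ℓ = 2: it is impossible to have a sequence (λₙ) of nonzero reals with |λₙ| → ∞ together with tuples Uₙ, Fₙ satisfying all the regularity assumptions, boundary conditions and resolvent equations of the setting with ℓ = 2, ‖Uₙ‖_H = 1 for all n, and ‖Fₙ‖_H → 0. (This is the frequency-domain criterion ‖(iλ − 𝒜)⁻¹‖ = O(λ²) underlying the polynomial energy decay rate t⁻¹ of the Bresse system when k₁/ρ₁ = k₂/ρ₂ and k₁ ≠ k₃.) -/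

import Mathlib

open Set Filter MeasureTheory

noncomputable section

/-- The resolvent-sequence setting for the locally damped Bresse system with
parameter `ℓ`: a sequence of nonzero frequencies `lam n` with `|lam n| → ∞`,
solutions `Uₙ = (v1,…,v6)` and right-hand sides `Fₙ = (f1,…,f6)` of the resolvent
equations `(lam n)^ℓ (i (lam n) I − 𝒜) Uₙ = Fₙ`, with `‖Uₙ‖_H = 1` and `‖Fₙ‖_H → 0`. -/
structure BresseSetting (ρ₁ ρ₂ k₁ k₂ k₃ l L β a₀ : ℝ) (ℓ : ℕ) where
  lam : ℕ → ℝ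
  v1 : ℕ → ℝ → ℂ
  v2 : ℕ → ℝ → ℂ
  v3 : ℕ → ℝ → ℂ
  v4 : ℕ → ℝ → ℂ
  v5 : ℕ → ℝ → ℂ
  v6 : ℕ → ℝ → ℂ
  f1 : ℕ → ℝ → ℂ
  f2 : ℕ → ℝ → ℂ
  f3 : ℕ → ℝ → ℂ
  f4 : ℕ → ℝ → ℂ
  f5 : ℕ → ℝ → ℂ
  f6 : ℕ → ℝ → ℂ
  lam_ne : ∀ n, lam n ≠ 0
  lam_tendsto : Tendsto (fun n => |lam n|) atTop atTop
  reg_v1 : ∀ n, ContDiffOn ℝ 2 (v1 n) (Icc 0 L)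
  reg_v3 : ∀ n, ContDiffOn ℝ 2 (v3 n) (Icc 0 L)
  reg_v5 : ∀ n, ContDiffOn ℝ 1 (v5 n) (Icc 0 L)
  reg_v5_left : ∀ n, ContDiffOn ℝ 2 (v5 n) (Icc 0 β)
  reg_v5_right : ∀ n, ContDiffOn ℝ 2 (v5 n) (Icc β L)
  reg_v2 : ∀ n, ContDiffOn ℝ 1 (v2 n) (Icc 0 L)
  reg_v4 : ∀ n, ContDiffOn ℝ 1 (v4 n) (Icc 0 L)
  reg_v6 : ∀ n, ContDiffOn ℝ 1 (v6 n) (Icc 0 L)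
  reg_f1 : ∀ n, ContDiffOn ℝ 1 (f1 n) (Icc 0 L)
  reg_f3 : ∀ n, ContDiffOn ℝ 1 (f3 n) (Icc 0 L)
  reg_f5 : ∀ n, ContDiffOn ℝ 1 (f5 n) (Icc 0 L)
  reg_f2 : ∀ n, ContinuousOn (f2 n) (Icc 0 L)
  reg_f4 : ∀ n, ContinuousOn (f4 n) (Icc 0 L)
  reg_f6 : ∀ n, ContinuousOn (f6 n) (Icc 0 L)
  bc_zero : ∀ n, v1 n 0 = 0 ∧ v2 n 0 = 0 ∧ v3 n 0 = 0 ∧ v4 n 0 = 0 ∧ v5 n 0 = 0 ∧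
      v6 n 0 = 0 ∧ f1 n 0 = 0 ∧ f3 n 0 = 0 ∧ f5 n 0 = 0
  bc_L : ∀ n, v1 n L = 0 ∧ v2 n L = 0 ∧ v3 n L = 0 ∧ v4 n L = 0 ∧ v5 n L = 0 ∧
      v6 n L = 0 ∧ f1 n L = 0 ∧ f3 n L = 0 ∧ f5 n L = 0
  eq1 : ∀ n, ∀ x ∈ Ioo (0 : ℝ) β ∪ Ioo β L,
      Complex.I * (lam n : ℂ) * v1 n x - v2 n x = (lam n : ℂ) ^ (-(ℓ : ℤ)) * f1 n x
  eq2 : ∀ n, ∀ x ∈ Ioo (0 : ℝ) β ∪ Ioo β L,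
      Complex.I * (lam n : ℂ) * (ρ₁ : ℂ) * v2 n x
        - (k₁ : ℂ) * deriv (fun y => deriv (v1 n) y + v3 n y + (l : ℂ) * v5 n y) x
        - (l : ℂ) * (k₃ : ℂ) * (deriv (v5 n) x - (l : ℂ) * v1 n x)
        = (ρ₁ : ℂ) * (lam n : ℂ) ^ (-(ℓ : ℤ)) * f2 n x
  eq3 : ∀ n, ∀ x ∈ Ioo (0 : ℝ) β ∪ Ioo β L,
      Complex.I * (lam n : ℂ) * v3 n x - v4 n x = (lam n : ℂ) ^ (-(ℓ : ℤ)) * f3 n x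
  eq4 : ∀ n, ∀ x ∈ Ioo (0 : ℝ) β ∪ Ioo β L,
      Complex.I * (lam n : ℂ) * (ρ₂ : ℂ) * v4 n x
        - (k₂ : ℂ) * deriv (deriv (v3 n)) x
        + (k₁ : ℂ) * (deriv (v1 n) x + v3 n x + (l : ℂ) * v5 n x)
        = (ρ₂ : ℂ) * (lam n : ℂ) ^ (-(ℓ : ℤ)) * f4 n x
  eq5 : ∀ n, ∀ x ∈ Ioo (0 : ℝ) β ∪ Ioo β L,
      Complex.I * (lam n : ℂ) * v5 n x - v6 n x = (lam n : ℂ) ^ (-(ℓ : ℤ)) * f5 n x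
  eq6 : ∀ n, ∀ x ∈ Ioo (0 : ℝ) β ∪ Ioo β L,
      Complex.I * (lam n : ℂ) * (ρ₁ : ℂ) * v6 n x
        - (k₃ : ℂ) * deriv (fun y => deriv (v5 n) y - (l : ℂ) * v1 n y) x
        + (l : ℂ) * (k₁ : ℂ) * (deriv (v1 n) x + v3 n x + (l : ℂ) * v5 n x)
        + (if x < β then (a₀ : ℂ) else 0) * v6 n x
        = (ρ₁ : ℂ) * (lam n : ℂ) ^ (-(ℓ : ℤ)) * f6 n x
  normU : ∀ n, (∫ x in (0 : ℝ)..L,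
      (k₁ * ‖deriv (v1 n) x + v3 n x + (l : ℂ) * v5 n x‖ ^ 2 + ρ₁ * ‖v2 n x‖ ^ 2
        + k₂ * ‖deriv (v3 n) x‖ ^ 2 + ρ₂ * ‖v4 n x‖ ^ 2
        + k₃ * ‖deriv (v5 n) x - (l : ℂ) * v1 n x‖ ^ 2 + ρ₁ * ‖v6 n x‖ ^ 2)) = 1
  normF : Tendsto (fun n => ∫ x in (0 : ℝ)..L,
      (k₁ * ‖deriv (f1 n) x + f3 n x + (l : ℂ) * f5 n x‖ ^ 2 + ρ₁ * ‖f2 n x‖ ^ 2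
        + k₂ * ‖deriv (f3 n) x‖ ^ 2 + ρ₂ * ‖f4 n x‖ ^ 2
        + k₃ * ‖deriv (f5 n) x - (l : ℂ) * f1 n x‖ ^ 2 + ρ₁ * ‖f6 n x‖ ^ 2))
      atTop (nhds 0)

set_option linter.unusedSimpArgs false

/-- Null sequences in `L²(a,b)` (of functions continuous on `[a,b]`). -/
def Sm (a b : ℝ) (f : ℕ → ℝ → ℂ) : Prop :=
  (∀ n, ContinuousOn (f n) (Icc a b)) ∧
    Tendsto (fun n => ∫ x in a..b, ‖f n x‖ ^ 2) atTop (nhds 0)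

/-- Bounded sequences in `L²(a,b)`. -/
def Bd (a b : ℝ) (f : ℕ → ℝ → ℂ) : Prop :=
  (∀ n, ContinuousOn (f n) (Icc a b)) ∧
    ∃ C : ℝ, ∀ᶠ n in atTop, ∫ x in a..b, ‖f n x‖ ^ 2 ≤ C

/-- Null sequences in `L¹(a,b)`. -/
def Zo (a b : ℝ) (f : ℕ → ℝ → ℂ) : Prop :=
  (∀ n, ContinuousOn (f n) (Icc a b)) ∧
    Tendsto (fun n => ∫ x in a..b, ‖f n x‖) atTop (nhds 0)

/-- Uniformly bounded multipliers. -/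
def Mb (a b : ℝ) (m : ℕ → ℝ → ℂ) : Prop :=
  (∀ n, ContinuousOn (m n) (Icc a b)) ∧
    ∃ C : ℝ, ∀ᶠ n in atTop, ∀ x ∈ Icc a b, ‖m n x‖ ≤ C

lemma ii_of_cont {E : Type*} [NormedAddCommGroup E] {a b : ℝ} (hab : a ≤ b) {f : ℝ → E}
    (hf : ContinuousOn f (Icc a b)) : IntervalIntegrable f volume a b :=
  hf.intervalIntegrable_of_Icc hab

lemma int_mono {a b : ℝ} (hab : a ≤ b) {f g : ℝ → ℝ}
    (hf : ContinuousOn f (Icc a b)) (hg : ContinuousOn g (Icc a b))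
    (h : ∀ x ∈ Icc a b, f x ≤ g x) : ∫ x in a..b, f x ≤ ∫ x in a..b, g x :=
  intervalIntegral.integral_mono_on hab (ii_of_cont hab hf) (ii_of_cont hab hg) h

lemma int_nn {a b : ℝ} (hab : a ≤ b) {f : ℝ → ℝ}
    (h : ∀ x ∈ Icc a b, 0 ≤ f x) : 0 ≤ ∫ x in a..b, f x :=
  intervalIntegral.integral_nonneg hab h

section
variable {a b : ℝ} {f g m : ℕ → ℝ → ℂ}

lemma Sm.of_le (hab : a ≤ b) (hf : ∀ n, ContinuousOn (f n) (Icc a b)) {T : ℕ → ℝ → ℝ}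
    (hT : ∀ n, ContinuousOn (T n) (Icc a b))
    (h : ∀ᶠ n in atTop, ∀ x ∈ Icc a b, ‖f n x‖ ^ 2 ≤ T n x)
    (hlim : Tendsto (fun n => ∫ x in a..b, T n x) atTop (nhds 0)) : Sm a b f := by
  refine ⟨hf, squeeze_zero' ?_ ?_ hlim⟩
  · exact Eventually.of_forall fun n => int_nn hab fun x _ => by positivity
  · filter_upwards [h] with n hn
    exact int_mono hab ((hf n).norm.pow 2) (hT n) hn

lemma Bd.of_le (hab : a ≤ b) (hf : ∀ n, ContinuousOn (f n) (Icc a b)) {T : ℕ → ℝ → ℝ}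
    (hT : ∀ n, ContinuousOn (T n) (Icc a b))
    (h : ∀ᶠ n in atTop, ∀ x ∈ Icc a b, ‖f n x‖ ^ 2 ≤ T n x) {C : ℝ}
    (hlim : ∀ᶠ n in atTop, ∫ x in a..b, T n x ≤ C) : Bd a b f := by
  refine ⟨hf, C, ?_⟩
  filter_upwards [h, hlim] with n hn hc
  exact (int_mono hab ((hf n).norm.pow 2) (hT n) hn).trans hc

lemma Zo.of_le (hab : a ≤ b) (hf : ∀ n, ContinuousOn (f n) (Icc a b)) {T : ℕ → ℝ → ℝ}
    (hT : ∀ n, ContinuousOn (T n) (Icc a b))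
    (h : ∀ᶠ n in atTop, ∀ x ∈ Icc a b, ‖f n x‖ ≤ T n x)
    (hlim : Tendsto (fun n => ∫ x in a..b, T n x) atTop (nhds 0)) : Zo a b f := by
  refine ⟨hf, squeeze_zero' ?_ ?_ hlim⟩
  · exact Eventually.of_forall fun n => int_nn hab fun x _ => by positivity
  · filter_upwards [h] with n hn
    exact int_mono hab ((hf n).norm) (hT n) hn

lemma Sm.bd (h : Sm a b f) : Bd a b f :=
  ⟨h.1, 1, (h.2.eventually (gt_mem_nhds one_pos)).mono fun _ h => le_of_lt h⟩

lemma Sm.congr (hab : a ≤ b) (h : Sm a b f) (e : ∀ n, ∀ x ∈ Icc a b, g n x = f n x) :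
    Sm a b g := by
  refine ⟨fun n => (h.1 n).congr (e n), h.2.congr fun n => ?_⟩
  apply intervalIntegral.integral_congr
  intro x hx
  rw [uIcc_of_le hab] at hx
  simp [e n x hx]

lemma Bd.congr (hab : a ≤ b) (h : Bd a b f) (e : ∀ n, ∀ x ∈ Icc a b, g n x = f n x) :
    Bd a b g := by
  obtain ⟨h1, C, hC⟩ := h
  refine ⟨fun n => (h1 n).congr (e n), C, ?_⟩
  filter_upwards [hC] with n hn
  refine le_of_eq_of_le ?_ hn
  apply intervalIntegral.integral_congr
  intro x hx
  rw [uIcc_of_le hab] at hx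
  simp [e n x hx]

lemma Sm.add (hab : a ≤ b) (hf : Sm a b f) (hg : Sm a b g) :
    Sm a b (fun n x => f n x + g n x) := by
  refine Sm.of_le hab (fun n => (hf.1 n).add (hg.1 n))
    (T := fun n x => 2 * ‖f n x‖ ^ 2 + 2 * ‖g n x‖ ^ 2) ?_ ?_ ?_
  · intro n
    exact (((hf.1 n).norm.pow 2).const_smul (2:ℝ)).add (((hg.1 n).norm.pow 2).const_smul (2:ℝ))
  · refine Eventually.of_forall fun n x _ => ?_
    have := norm_add_le (f n x) (g n x)
    nlinarith [sq_nonneg (‖f n x‖ - ‖g n x‖), norm_nonneg (f n x + g n x), norm_nonneg (f n x), norm_nonneg (g n x)]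
  · have := (hf.2.const_mul 2).add (hg.2.const_mul 2)
    simp only [mul_zero, add_zero] at this
    refine this.congr fun n => ?_
    rw [intervalIntegral.integral_add, intervalIntegral.integral_const_mul,
      intervalIntegral.integral_const_mul]
    · exact (ii_of_cont hab ((hf.1 n).norm.pow 2)).const_mul 2
    · exact (ii_of_cont hab ((hg.1 n).norm.pow 2)).const_mul 2

lemma Bd.add (hab : a ≤ b) (hf : Bd a b f) (hg : Bd a b g) :
    Bd a b (fun n x => f n x + g n x) := by
  obtain ⟨hf, C, hC⟩ := hf
  obtain ⟨hg, D, hD⟩ := hg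
  refine Bd.of_le hab (fun n => (hf n).add (hg n))
    (T := fun n x => 2 * ‖f n x‖ ^ 2 + 2 * ‖g n x‖ ^ 2) (C := 2 * C + 2 * D) ?_ ?_ ?_
  · intro n
    exact (((hf n).norm.pow 2).const_smul (2:ℝ)).add (((hg n).norm.pow 2).const_smul (2:ℝ))
  · refine Eventually.of_forall fun n x _ => ?_
    have := norm_add_le (f n x) (g n x)
    nlinarith [sq_nonneg (‖f n x‖ - ‖g n x‖), norm_nonneg (f n x + g n x), norm_nonneg (f n x), norm_nonneg (g n x)]
  · filter_upwards [hC, hD] with n h1 h2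
    rw [intervalIntegral.integral_add, intervalIntegral.integral_const_mul,
      intervalIntegral.integral_const_mul]
    · linarith
    · exact (ii_of_cont hab ((hf n).norm.pow 2)).const_mul 2
    · exact (ii_of_cont hab ((hg n).norm.pow 2)).const_mul 2

lemma Zo.add (hab : a ≤ b) (hf : Zo a b f) (hg : Zo a b g) :
    Zo a b (fun n x => f n x + g n x) := by
  refine Zo.of_le hab (fun n => (hf.1 n).add (hg.1 n))
    (T := fun n x => ‖f n x‖ + ‖g n x‖) ?_ ?_ ?_
  · intro n
    exact ((hf.1 n).norm).add ((hg.1 n).norm)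
  · exact Eventually.of_forall fun n x _ => norm_add_le (f n x) (g n x)
  · have := hf.2.add hg.2
    simp only [add_zero] at this
    refine this.congr fun n => ?_
    rw [intervalIntegral.integral_add]
    · exact (ii_of_cont hab ((hf.1 n).norm))
    · exact (ii_of_cont hab ((hg.1 n).norm))

lemma Sm.mmul (hab : a ≤ b) (hm : Mb a b m) (hf : Sm a b f) :
    Sm a b (fun n x => m n x * f n x) := by
  obtain ⟨hm, C, hC⟩ := hm
  refine Sm.of_le hab (fun n => (hm n).mul (hf.1 n)) (T := fun n x => C ^ 2 * ‖f n x‖ ^ 2) ?_ ?_ ?_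
  · intro n
    exact (((hf.1 n).norm.pow 2).const_smul (C ^ 2))
  · filter_upwards [hC] with n hn x hx
    rw [norm_mul, mul_pow]
    have := hn x hx
    gcongr
  · have := hf.2.const_mul (C ^ 2)
    simp only [mul_zero] at this
    refine this.congr fun n => ?_
    rw [intervalIntegral.integral_const_mul]

lemma Bd.mmul (hab : a ≤ b) (hm : Mb a b m) (hf : Bd a b f) :
    Bd a b (fun n x => m n x * f n x) := by
  obtain ⟨hm, C, hC⟩ := hm
  obtain ⟨hf, D, hD⟩ := hf
  refine Bd.of_le hab (fun n => (hm n).mul (hf n)) (T := fun n x => C ^ 2 * ‖f n x‖ ^ 2)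
    (C := C ^ 2 * D) ?_ ?_ ?_
  · intro n
    exact (((hf n).norm.pow 2).const_smul (C ^ 2))
  · filter_upwards [hC] with n hn x hx
    rw [norm_mul, mul_pow]
    have := hn x hx
    gcongr
  · filter_upwards [hD] with n hn
    rw [intervalIntegral.integral_const_mul]
    gcongr

lemma Zo.mmul (hab : a ≤ b) (hm : Mb a b m) (hf : Zo a b f) :
    Zo a b (fun n x => m n x * f n x) := by
  obtain ⟨hm, C, hC⟩ := hm
  refine Zo.of_le hab (fun n => (hm n).mul (hf.1 n)) (T := fun n x => C * ‖f n x‖) ?_ ?_ ?_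
  · intro n
    exact (((hf.1 n).norm).const_smul C)
  · filter_upwards [hC] with n hn x hx
    rw [norm_mul]
    have := hn x hx
    gcongr
  · have := hf.2.const_mul C
    simp only [mul_zero] at this
    refine this.congr fun n => ?_
    rw [intervalIntegral.integral_const_mul]

lemma Bd.null (hab : a ≤ b) (hf : Bd a b f) {c : ℕ → ℂ} (hc : Tendsto c atTop (nhds 0)) :
    Sm a b (fun n x => c n * f n x) := by
  obtain ⟨hf, D, hD⟩ := hf
  refine ⟨fun n => continuousOn_const.mul (hf n), ?_⟩
  have h1 : Tendsto (fun n => ‖c n‖ ^ 2 * D) atTop (nhds 0) := by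
    have := (hc.norm.pow 2).mul_const D
    simpa using this
  refine squeeze_zero' ?_ ?_ h1
  · exact Eventually.of_forall fun n => int_nn hab fun x _ => by positivity
  · filter_upwards [hD] with n hn
    simp only [norm_mul, mul_pow]
    rw [intervalIntegral.integral_const_mul]
    gcongr

lemma Sm.star (h : Sm a b f) : Sm a b (fun n x => star (f n x)) :=
  ⟨fun n => (h.1 n).star, by simpa using h.2⟩

lemma Bd.star (h : Bd a b f) : Bd a b (fun n x => star (f n x)) :=
  ⟨fun n => (h.1 n).star, by simpa using h.2⟩

lemma Zo.star (h : Zo a b f) : Zo a b (fun n x => star (f n x)) :=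
  ⟨fun n => (h.1 n).star, by simpa using h.2⟩

lemma Mb.fix {k : ℝ → ℂ} (hk : ContinuousOn k (Icc a b)) : Mb a b (fun _ => k) := by
  refine ⟨fun _ => hk, ?_⟩
  obtain ⟨C, hC⟩ := isCompact_Icc.exists_bound_of_continuousOn hk
  exact ⟨C, Eventually.of_forall fun n => hC⟩

lemma Mb.cst (c : ℂ) : Mb a b (fun _ _ => c) := Mb.fix continuousOn_const

lemma Mb.seq {c : ℕ → ℂ} {c0 : ℂ} (hc : Tendsto c atTop (nhds c0)) : Mb a b (fun n _ => c n) := by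
  refine ⟨fun _ => continuousOn_const, ‖c0‖ + 1, ?_⟩
  filter_upwards [hc.norm.eventually (gt_mem_nhds (lt_add_one _))] with n hn x _ using hn.le

lemma Sm.cmul (hab : a ≤ b) (c : ℂ) (hf : Sm a b f) : Sm a b (fun n x => c * f n x) :=
  Sm.mmul hab (Mb.cst c) hf
lemma Bd.cmul (hab : a ≤ b) (c : ℂ) (hf : Bd a b f) : Bd a b (fun n x => c * f n x) :=
  Bd.mmul hab (Mb.cst c) hf
lemma Zo.cmul (hab : a ≤ b) (c : ℂ) (hf : Zo a b f) : Zo a b (fun n x => c * f n x) :=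
  Zo.mmul hab (Mb.cst c) hf

lemma Zo.prod (hab : a ≤ b) (hf : Sm a b f) (hg : Bd a b g) :
    Zo a b (fun n x => f n x * g n x) := by
  obtain ⟨hgc, C, hC⟩ := hg
  refine ⟨fun n => (hf.1 n).mul (hgc n), ?_⟩
  have key : ∀ᶠ n in atTop, ∫ x in a..b, ‖f n x * g n x‖ ≤
      Real.sqrt ((∫ x in a..b, ‖f n x‖ ^ 2) * |C|) := by
    filter_upwards [hC] with n hn
    set A := ∫ x in a..b, ‖f n x‖ ^ 2 with hA
    set B := ∫ x in a..b, ‖g n x‖ ^ 2 with hB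
    set P := ∫ x in a..b, ‖f n x * g n x‖ with hP
    have hA0 : 0 ≤ A := int_nn hab fun x _ => by positivity
    have hP0 : 0 ≤ P := int_nn hab fun x _ => by positivity
    have hq : ∀ t : ℝ, 0 ≤ A * (t * t) + (2 * P) * t + B := by
      intro t
      have e : A * (t * t) + (2 * P) * t + B =
          ∫ x in a..b, ((t * t) * ‖f n x‖ ^ 2 + (2 * t) * ‖f n x * g n x‖ + ‖g n x‖ ^ 2) := by
        have i1 : IntervalIntegrable (fun x => (t * t) * ‖f n x‖ ^ 2) volume a b :=
          (ii_of_cont hab ((hf.1 n).norm.pow 2)).const_mul (t * t)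
        have i2 : IntervalIntegrable (fun x => (2 * t) * ‖f n x * g n x‖) volume a b :=
          (ii_of_cont hab ((hf.1 n).mul (hgc n)).norm).const_mul (2 * t)
        have i3 : IntervalIntegrable (fun x => ‖g n x‖ ^ 2) volume a b :=
          (ii_of_cont hab ((hgc n).norm.pow 2))
        rw [intervalIntegral.integral_add (i1.add i2) i3, intervalIntegral.integral_add i1 i2,
          intervalIntegral.integral_const_mul, intervalIntegral.integral_const_mul]
        ring
      rw [e]
      apply int_nn hab
      intro x _
      rw [norm_mul]
      nlinarith [sq_nonneg (t * ‖f n x‖ + ‖g n x‖)]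
    have hd := discrim_le_zero hq
    rw [discrim] at hd
    apply Real.le_sqrt_of_sq_le
    have : A * B ≤ A * |C| := by
      gcongr
      exact hn.trans (le_abs_self C)
    nlinarith
  refine squeeze_zero' ?_ key ?_
  · exact Eventually.of_forall fun n => int_nn hab fun x _ => by positivity
  · have := (hf.2.mul_const |C|).sqrt
    simpa using this

lemma sub_bound {c d : ℝ} (hac : a ≤ c) (hcd : c ≤ d) (hdb : d ≤ b) {F : ℝ → ℝ}
    (hF : ContinuousOn F (Icc a b)) (h0 : ∀ x, 0 ≤ F x) :
    ∫ x in c..d, F x ≤ ∫ x in a..b, F x := by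
  apply intervalIntegral.integral_mono_interval hac hcd hdb
  · exact Eventually.of_forall fun x => h0 x
  · exact ii_of_cont (hac.trans (hcd.trans hdb)) hF

lemma Sm.sub {c d : ℝ} (hac : a ≤ c) (hcd : c ≤ d) (hdb : d ≤ b) (h : Sm a b f) : Sm c d f := by
  refine ⟨fun n => (h.1 n).mono (Icc_subset_Icc hac hdb), squeeze_zero ?_ ?_ h.2⟩
  · exact fun n => int_nn hcd fun x _ => by positivity
  · exact fun n => sub_bound (F := fun x => ‖f n x‖ ^ 2) hac hcd hdb ((h.1 n).norm.pow 2) fun x => by positivity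

lemma Bd.sub {c d : ℝ} (hac : a ≤ c) (hcd : c ≤ d) (hdb : d ≤ b) (h : Bd a b f) : Bd c d f := by
  obtain ⟨h1, C, hC⟩ := h
  refine ⟨fun n => (h1 n).mono (Icc_subset_Icc hac hdb), C, ?_⟩
  filter_upwards [hC] with n hn
  exact (sub_bound (F := fun x => ‖f n x‖ ^ 2) hac hcd hdb ((h1 n).norm.pow 2)
    fun x => by positivity).trans hn

lemma Zo.int (hab : a ≤ b) (h : Zo a b f) :
    Tendsto (fun n => ∫ x in a..b, f n x) atTop (nhds 0) :=
  squeeze_zero_norm (fun _ => intervalIntegral.norm_integral_le_integral_norm hab) h.2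

lemma ftcz (hab : a ≤ b) {G D S : ℕ → ℝ → ℂ} (hG : ∀ n, ContinuousOn (G n) (Icc a b))
    (hD : ∀ n, ContinuousOn (D n) (Icc a b)) (hS : Zo a b S)
    (hd : ∀ n, ∀ x ∈ Ioo a b, HasDerivAt (G n) (D n x + S n x) x) :
    Tendsto (fun n => G n b - G n a - ∫ x in a..b, D n x) atTop (nhds 0) := by
  refine (hS.int hab).congr fun n => ?_
  have i1 := ii_of_cont hab (hD n)
  have i2 := ii_of_cont hab (hS.1 n)
  rw [← intervalIntegral.integral_eq_sub_of_hasDerivAt_of_le hab (hG n) (hd n) (i1.add i2),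
    intervalIntegral.integral_add i1 i2]
  ring

lemma star_mul_self_eq (z : ℂ) : z * star z = ((‖z‖ ^ 2 : ℝ) : ℂ) := by
  rw [Complex.star_def, Complex.mul_conj, Complex.normSq_eq_norm_sq]

lemma keyl (hab : a ≤ b) {G S : ℕ → ℝ → ℂ} {c : ℂ} (hc : c ≠ 0)
    (hf : ∀ n, ContinuousOn (f n) (Icc a b))
    (hG : ∀ n, ContinuousOn (G n) (Icc a b)) (hS : Zo a b S)
    (ha0 : ∀ n, G n a = 0) (hb0 : ∀ n, G n b = 0)
    (hd : ∀ n, ∀ x ∈ Ioo a b, HasDerivAt (G n) (c * (f n x * star (f n x)) + S n x) x) :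
    Sm a b f := by
  refine ⟨hf, ?_⟩
  have h := ftcz hab hG (D := fun n x => c * (f n x * star (f n x)))
    (fun n => continuousOn_const.mul ((hf n).mul (hf n).star)) hS hd
  have h2 := ((h.const_mul (c⁻¹)).norm)
  simp only [mul_zero, norm_zero] at h2
  refine h2.congr fun n => ?_
  rw [ha0, hb0, intervalIntegral.integral_const_mul]
  simp only [star_mul_self_eq]
  rw [intervalIntegral.integral_ofReal]
  have : c⁻¹ * (0 - 0 - c * ((∫ x in a..b, ‖f n x‖ ^ 2 : ℝ) : ℂ)) =
    -((∫ x in a..b, ‖f n x‖ ^ 2 : ℝ) : ℂ) := by field_simp; ring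
  rw [this, norm_neg, Complex.norm_real, Real.norm_eq_abs, abs_of_nonneg]
  exact int_nn hab fun x _ => by positivity

/-- Poincaré type statement. -/
lemma poinc (hab : a ≤ b) {u d : ℕ → ℝ → ℂ} (hu : ∀ n, ContinuousOn (u n) (Icc a b))
    (h0 : ∀ n, u n a = 0) (hd : Sm a b d) (h : ∀ n, ∀ x ∈ Ioo a b, HasDerivAt (u n) (d n x) x) :
    Sm a b u := by
  have hz : Zo a b (fun n x => d n x * 1) :=
    Zo.prod hab hd ⟨fun _ => continuousOn_const, ∫ x in a..b, ‖(1:ℂ)‖ ^ 2, by simp⟩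
  simp only [mul_one] at hz
  have hb : ∀ n, ∀ x ∈ Icc a b, ‖u n x‖ ≤ ∫ y in a..b, ‖d n y‖ := by
    intro n x hx
    have e := intervalIntegral.integral_eq_sub_of_hasDerivAt_of_le hx.1
      ((hu n).mono (Icc_subset_Icc_right hx.2))
      (fun y hy => h n y ⟨hy.1, hy.2.trans_le hx.2⟩)
      (ii_of_cont hx.1 ((hd.1 n).mono (Icc_subset_Icc_right hx.2)))
    rw [h0, sub_zero] at e
    rw [← e]
    refine (intervalIntegral.norm_integral_le_integral_norm hx.1).trans ?_
    exact sub_bound le_rfl hx.1 hx.2 (hd.1 n).norm fun _ => norm_nonneg _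
  refine Sm.of_le hab hu (T := fun n _ => (∫ y in a..b, ‖d n y‖) ^ 2)
    (fun n => continuousOn_const) ?_ ?_
  · refine Eventually.of_forall fun n x hx => ?_
    have := hb n x hx
    gcongr
  · have := (hz.2.pow 2).const_mul (b - a)
    simpa using this

end

/-- The reduced second order system on a subinterval. -/
structure Piece (ρ₁ ρ₂ k₁ k₂ k₃ K : ℝ) (a b : ℝ) (lam : ℕ → ℝ)
    (φ φ1 ψ ψ1 w w1 R2 R4 R6 : ℕ → ℝ → ℂ) : Prop where
  cφ : ∀ n, ContinuousOn (φ n) (Icc a b)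
  cψ : ∀ n, ContinuousOn (ψ n) (Icc a b)
  cw : ∀ n, ContinuousOn (w n) (Icc a b)
  bφ : Bd a b (fun n x => (lam n : ℂ) * φ n x)
  bψ : Bd a b (fun n x => (lam n : ℂ) * ψ n x)
  bw : Bd a b (fun n x => (lam n : ℂ) * w n x)
  bφ1 : Bd a b φ1
  bψ1 : Bd a b ψ1
  bw1 : Bd a b w1
  s2 : Sm a b R2
  s4 : Sm a b R4
  s6 : Sm a b R6
  dφ : ∀ n, ∀ x ∈ Ioo a b, HasDerivAt (φ n) (φ1 n x) x
  dψ : ∀ n, ∀ x ∈ Ioo a b, HasDerivAt (ψ n) (ψ1 n x) x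
  dw : ∀ n, ∀ x ∈ Ioo a b, HasDerivAt (w n) (w1 n x) x
  dφ1 : ∀ n, ∀ x ∈ Ioo a b, HasDerivAt (φ1 n)
    ((-(lam n : ℂ) ^ 2 * ρ₁ * φ n x - k₁ * ψ1 n x - K * w1 n x + R2 n x) / k₁) x
  dψ1 : ∀ n, ∀ x ∈ Ioo a b, HasDerivAt (ψ1 n)
    ((-(lam n : ℂ) ^ 2 * ρ₂ * ψ n x + k₁ * φ1 n x + R4 n x) / k₂) x
  dw1 : ∀ n, ∀ x ∈ Ioo a b, HasDerivAt (w1 n)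
    ((-(lam n : ℂ) ^ 2 * ρ₁ * w n x + K * φ1 n x + R6 n x) / k₃) x

lemma star_real (r : ℝ) : star (r : ℂ) = (r : ℂ) := by
  rw [Complex.star_def, Complex.conj_ofReal]

/-- Energy density. -/
def En (ρ₁ ρ₂ k₁ k₂ k₃ : ℝ) (lam : ℕ → ℝ) (φ φ1 ψ ψ1 w w1 : ℕ → ℝ → ℂ) (n : ℕ) (x : ℝ) : ℂ :=
  ρ₁ * (lam n : ℂ) ^ 2 * (φ n x * star (φ n x)) + k₁ * (φ1 n x * star (φ1 n x))
  + ρ₂ * (lam n : ℂ) ^ 2 * (ψ n x * star (ψ n x)) + k₂ * (ψ1 n x * star (ψ1 n x))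
  + ρ₁ * (lam n : ℂ) ^ 2 * (w n x * star (w n x)) + k₃ * (w1 n x * star (w1 n x))

section
variable {ρ₁ ρ₂ k₁ k₂ k₃ K a b : ℝ} {lam : ℕ → ℝ} {φ φ1 ψ ψ1 w w1 R2 R4 R6 : ℕ → ℝ → ℂ}

lemma Piece.cE (P : Piece ρ₁ ρ₂ k₁ k₂ k₃ K a b lam φ φ1 ψ ψ1 w w1 R2 R4 R6) (n : ℕ) :
    ContinuousOn (En ρ₁ ρ₂ k₁ k₂ k₃ lam φ φ1 ψ ψ1 w w1 n) (Icc a b) := by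
  have := P.cφ n
  have := P.cψ n
  have := P.cw n
  have := P.bφ1.1 n
  have := P.bψ1.1 n
  have := P.bw1.1 n
  unfold En
  fun_prop

lemma Piece.dE (P : Piece ρ₁ ρ₂ k₁ k₂ k₃ K a b lam φ φ1 ψ ψ1 w w1 R2 R4 R6)
    (hk1 : 0 < k₁) (hk2 : 0 < k₂) (hk3 : 0 < k₃) (n : ℕ) (x : ℝ) (hx : x ∈ Ioo a b) :
    HasDerivAt (En ρ₁ ρ₂ k₁ k₂ k₃ lam φ φ1 ψ ψ1 w w1 n)
      ((R2 n x * star (φ1 n x) + R4 n x * star (ψ1 n x) + R6 n x * star (w1 n x))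
      + star (R2 n x * star (φ1 n x) + R4 n x * star (ψ1 n x) + R6 n x * star (w1 n x))) x := by
  have h1 : (k₁ : ℂ) ≠ 0 := by exact_mod_cast hk1.ne'
  have h2 : (k₂ : ℂ) ≠ 0 := by exact_mod_cast hk2.ne'
  have h3 : (k₃ : ℂ) ≠ 0 := by exact_mod_cast hk3.ne'
  have d1 := P.dφ n x hx
  have d2 := P.dψ n x hx
  have d3 := P.dw n x hx
  have d4 := P.dφ1 n x hx
  have d5 := P.dψ1 n x hx
  have d6 := P.dw1 n x hx
  unfold En
  refine HasDerivAt.congr_deriv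
    (((((((d1.fun_mul d1.star).const_mul _).fun_add ((d4.fun_mul d4.star).const_mul _)).fun_add
    ((d2.fun_mul d2.star).const_mul _)).fun_add ((d5.fun_mul d5.star).const_mul _)).fun_add
    ((d3.fun_mul d3.star).const_mul _)).fun_add ((d6.fun_mul d6.star).const_mul _)) ?_
  simp only [star_add, star_sub, star_neg, star_mul', star_div₀, star_pow, star_real, star_star]
  field_simp
  ring

lemma Piece.energy (hab : a ≤ b) (P : Piece ρ₁ ρ₂ k₁ k₂ k₃ K a b lam φ φ1 ψ ψ1 w w1 R2 R4 R6)
    (hk1 : 0 < k₁) (hk2 : 0 < k₂) (hk3 : 0 < k₃) {q q' : ℝ → ℂ}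
    (hq : ∀ x, HasDerivAt q (q' x) x) (hq' : Continuous q') :
    Tendsto (fun n => q b * En ρ₁ ρ₂ k₁ k₂ k₃ lam φ φ1 ψ ψ1 w w1 n b
      - q a * En ρ₁ ρ₂ k₁ k₂ k₃ lam φ φ1 ψ ψ1 w w1 n a
      - ∫ x in a..b, q' x * En ρ₁ ρ₂ k₁ k₂ k₃ lam φ φ1 ψ ψ1 w w1 n x) atTop (nhds 0) := by
  have hqc : Continuous q := continuous_iff_continuousAt.2 fun x => (hq x).continuousAt
  have hZ := ((Zo.prod hab P.s2 P.bφ1.star).add hab (Zo.prod hab P.s4 P.bψ1.star)).add hab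
    (Zo.prod hab P.s6 P.bw1.star)
  have hS := (hZ.add hab hZ.star).mmul hab (Mb.fix hqc.continuousOn)
  refine ftcz hab (G := fun n x => q x * En ρ₁ ρ₂ k₁ k₂ k₃ lam φ φ1 ψ ψ1 w w1 n x)
    (D := fun n x => q' x * En ρ₁ ρ₂ k₁ k₂ k₃ lam φ φ1 ψ ψ1 w w1 n x)
    (fun n => hqc.continuousOn.mul (P.cE n)) (fun n => hq'.continuousOn.mul (P.cE n)) hS ?_
  intro n x hx
  exact (hq x).fun_mul (P.dE hk1 hk2 hk3 n x hx)

lemma lam_inv_tendsto (hlam : Tendsto (fun n => |lam n|) atTop atTop) :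
    Tendsto (fun n => ((lam n : ℂ))⁻¹) atTop (nhds 0) := by
  rw [tendsto_zero_iff_norm_tendsto_zero]
  have h : Tendsto (fun n => |lam n|⁻¹) atTop (nhds 0) := hlam.inv_tendsto_atTop
  simpa using h

/-- Local smallness on the damped region. -/
lemma Piece.loc_small (hb : 0 < b) (P : Piece ρ₁ ρ₂ k₁ k₂ k₃ K 0 b lam φ φ1 ψ ψ1 w w1 R2 R4 R6)
    (hne : ∀ n, lam n ≠ 0)
    (hlam : Tendsto (fun n => |lam n|) atTop atTop)
    (hr1 : 0 < ρ₁) (hr2 : 0 < ρ₂)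
    (hk1 : 0 < k₁) (hk2 : 0 < k₂) (hk3 : 0 < k₃) (hK : 0 < K) (hsp : k₁ / ρ₁ = k₂ / ρ₂)
    (hw : Sm 0 b (fun n x => (lam n : ℂ) ^ 2 * w n x)) :
    Tendsto (fun n => ∫ x in (0:ℝ)..b, ((x:ℂ) * ((b:ℂ) - x)) ^ 2 *
      En ρ₁ ρ₂ k₁ k₂ k₃ lam φ φ1 ψ ψ1 w w1 n x) atTop (nhds 0) := by
  have hab := hb.le
  have h1 : (k₁ : ℂ) ≠ 0 := by exact_mod_cast hk1.ne'
  have h2 : (k₂ : ℂ) ≠ 0 := by exact_mod_cast hk2.ne'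
  have h3 : (k₃ : ℂ) ≠ 0 := by exact_mod_cast hk3.ne'
  have h4 : (K : ℂ) ≠ 0 := by exact_mod_cast hK.ne'
  have h5 : (ρ₁ : ℂ) ≠ 0 := by exact_mod_cast hr1.ne'
  have h6 : (ρ₂ : ℂ) ≠ 0 := by exact_mod_cast hr2.ne'
  have hl : ∀ n, (lam n : ℂ) ≠ 0 := fun n => by exact_mod_cast hne n
  have hmu := lam_inv_tendsto hlam
  set g : ℝ → ℂ := fun x => (x:ℂ) * ((b:ℂ) - x) with hg
  set g' : ℝ → ℂ := fun x => (b:ℂ) - 2 * x with hg'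
  have hgc : Continuous g := by fun_prop
  have hgc' : Continuous g' := by fun_prop
  have gd : ∀ x, HasDerivAt g (g' x) x := by
    intro x
    have hx : HasDerivAt (fun x : ℝ => (x:ℂ)) 1 x := Complex.ofRealCLM.hasDerivAt
    refine (hx.fun_mul (hx.const_sub (b:ℂ))).congr_deriv ?_
    simp only [hg']; ring
  have g0 : g 0 = 0 := by simp [hg]
  have gb : g b = 0 := by simp [hg]
  have gs : ∀ x, star (g x) = g x := by
    intro x; simp only [hg, star_mul', star_sub, star_real]
  have hd : ∀ x, HasDerivAt (fun x => g x * g x) (2 * g' x * g x) x := fun x =>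
    ((gd x).fun_mul (gd x)).congr_deriv (by ring)
  have Mg : Mb 0 b (fun _ => g) := Mb.fix hgc.continuousOn
  have Mg' : Mb 0 b (fun _ => g') := Mb.fix hgc'.continuousOn
  have cφ1 := P.bφ1.1
  have cψ1 := P.bψ1.1
  have cw1 := P.bw1.1
  have cφ := P.cφ
  have cψ := P.cψ
  have cw := P.cw
  -- small order terms
  have sφ : Sm 0 b φ := (P.bφ.null hab hmu).congr hab fun n x _ => by field_simp [hl n]
  have sψ : Sm 0 b ψ := (P.bψ.null hab hmu).congr hab fun n x _ => by field_simp [hl n]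
  -- step 1
  have S1 : Sm 0 b (fun n x => (lam n : ℂ) * g x * w1 n x) := by
    have bw2 := (((hw.bd.cmul hab (-(ρ₁:ℂ))).add hab (P.bφ1.cmul hab K)).add hab P.s6.bd).cmul hab
      ((k₃:ℂ)⁻¹)
    have hS := (Zo.prod hab hw.star ((P.bw1.mmul hab Mg').cmul hab 2)).mmul hab Mg |>.add hab
      ((Zo.prod hab hw.star bw2).mmul hab Mg |>.mmul hab Mg)
    refine keyl hab (G := fun n x => (g x * g x) * (w1 n x * ((lam n : ℂ) ^ 2 * star (w n x))))
      one_ne_zero ?_ ?_ hS ?_ ?_ ?_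
    · intro n; have := cw1 n; fun_prop
    · intro n; have := cw1 n; have := cw n; fun_prop
    · intro n; simp [g0]
    · intro n; simp [gb]
    · intro n x hx
      refine HasDerivAt.congr_deriv ((hd x).fun_mul ((P.dw1 n x hx).fun_mul
        ((P.dw n x hx).star.const_mul _))) ?_
      simp only [star_add, star_sub, star_neg, star_mul', star_div₀, star_pow, star_real, star_star, gs]
      field_simp
      ring
  have S1' : Sm 0 b (fun n x => g x * w1 n x) :=
    (S1.bd.null hab hmu).congr hab fun n x _ => by field_simp [hl n]
  -- step 2
  have S2 : Sm 0 b (fun n x => g x * φ1 n x) := by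
    have b2 : Bd 0 b (fun n x => (k₁:ℂ)⁻¹ * (-(ρ₁:ℂ) * ((lam n : ℂ) * φ n x)
        + (lam n : ℂ)⁻¹ * (-(k₁:ℂ) * ψ1 n x + -(K:ℂ) * w1 n x + R2 n x))) :=
      ((P.bφ.cmul hab _).add hab (((((P.bψ1.cmul hab _).add hab (P.bw1.cmul hab _)).add hab
        P.s2.bd).null hab hmu).bd)).cmul hab _
    have hS := ((Zo.prod hab S1' (P.bφ1.star.mmul hab Mg')).cmul hab 2).add hab
      (((Zo.prod hab (((hw.cmul hab (-(ρ₁:ℂ))).add hab P.s6).cmul hab (k₃:ℂ)⁻¹)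
        P.bφ1.star).mmul hab Mg |>.mmul hab Mg).add hab
      ((Zo.prod hab S1 b2.star).mmul hab Mg))
    refine keyl hab (G := fun n x => (g x * g x) * (w1 n x * star (φ1 n x)))
      (c := (K:ℂ) / k₃) (by positivity) ?_ ?_ hS ?_ ?_ ?_
    · intro n; have := cφ1 n; fun_prop
    · intro n; have := cw1 n; have := cφ1 n; fun_prop
    · intro n; simp [g0]
    · intro n; simp [gb]
    · intro n x hx
      have := hl n
      refine HasDerivAt.congr_deriv ((hd x).fun_mul ((P.dw1 n x hx).fun_mul
        (P.dφ1 n x hx).star)) ?_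
      simp only [star_add, star_sub, star_neg, star_mul', star_div₀, star_inv₀, star_pow, star_real, star_star, gs]
      field_simp
      ring
  -- step 3
  have S3 : Sm 0 b (fun n x => (lam n : ℂ) * g x * φ n x) := by
    have b2 := (((P.bψ1.cmul hab (-(k₁:ℂ))).add hab (P.bw1.cmul hab (-(K:ℂ)))).add hab
        P.s2.bd).cmul hab ((k₁:ℂ)⁻¹)
    have hS := ((Zo.prod hab sφ.star (P.bφ1.mmul hab Mg')).cmul hab 2 |>.mmul hab Mg).add hab
      (((Zo.prod hab sφ.star b2).mmul hab Mg |>.mmul hab Mg).add hab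
      (Zo.prod hab S2 S2.star.bd))
    refine keyl hab (G := fun n x => (g x * g x) * (φ1 n x * star (φ n x)))
      (c := -(ρ₁:ℂ) / k₁) (by simp [h5, h1]) ?_ ?_ hS ?_ ?_ ?_
    · intro n; have := cφ n; fun_prop
    · intro n; have := cφ n; have := cφ1 n; fun_prop
    · intro n; simp [g0]
    · intro n; simp [gb]
    · intro n x hx
      refine HasDerivAt.congr_deriv ((hd x).fun_mul ((P.dφ1 n x hx).fun_mul
        (P.dφ n x hx).star)) ?_
      simp only [star_add, star_sub, star_neg, star_mul', star_div₀, star_inv₀, star_pow, star_real, star_star, gs]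
      field_simp
      ring
  -- step 4
  have S4 : Sm 0 b (fun n x => g x * ψ1 n x) := by
    have hsp' : (k₁:ℂ) * ρ₂ = k₂ * ρ₁ := by
      rw [div_eq_div_iff hr1.ne' hr2.ne'] at hsp
      exact_mod_cast hsp
    have hρ : (ρ₂:ℂ) = k₂ * ρ₁ / k₁ := by field_simp; linear_combination hsp'
    have hS := (((Zo.prod hab S2 (P.bψ1.star.mmul hab Mg')).cmul hab 2).add hab
      ((Zo.prod hab S3 (P.bψ.star.mmul hab Mg')).cmul hab (2 * ((ρ₁:ℂ) / k₁)))).add hab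
      (((Zo.prod hab ((S1'.cmul hab (-(K:ℂ))).add hab (P.s2.mmul hab Mg)) P.bψ1.star).mmul hab
        Mg |>.cmul hab (k₁:ℂ)⁻¹).add hab
      ((Zo.prod hab S2 (((P.bφ1.star.cmul hab (k₁:ℂ)).add hab P.s4.star.bd).mmul hab Mg)).cmul hab
        (k₂:ℂ)⁻¹))
    refine keyl hab (G := fun n x => (g x * g x) * (φ1 n x * star (ψ1 n x)) +
        (g x * g x) * (((ρ₁:ℂ) / k₁ * (lam n : ℂ) ^ 2) * (φ n x * star (ψ n x))))
      (c := -1) (by simp) ?_ ?_ hS ?_ ?_ ?_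
    · intro n; have := cψ1 n; fun_prop
    · intro n; have := cφ n; have := cφ1 n; have := cψ n; have := cψ1 n; fun_prop
    · intro n; simp [g0]
    · intro n; simp [gb]
    · intro n x hx
      refine HasDerivAt.congr_deriv (((hd x).fun_mul ((P.dφ1 n x hx).fun_mul
        (P.dψ1 n x hx).star)).fun_add ((hd x).fun_mul (((P.dφ n x hx).fun_mul
        (P.dψ n x hx).star).const_mul _))) ?_
      simp only [star_add, star_sub, star_neg, star_mul', star_div₀, star_inv₀, star_pow, star_real, star_star, gs, hρ]
      field_simp
      ring
  -- step 5
  have S5 : Sm 0 b (fun n x => (lam n : ℂ) * g x * ψ n x) := by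
    have b2 := ((P.bφ1.cmul hab (k₁:ℂ)).add hab P.s4.bd).cmul hab ((k₂:ℂ)⁻¹)
    have hS := ((Zo.prod hab sψ.star (P.bψ1.mmul hab Mg')).cmul hab 2 |>.mmul hab Mg).add hab
      (((Zo.prod hab sψ.star b2).mmul hab Mg |>.mmul hab Mg).add hab
      (Zo.prod hab S4 S4.star.bd))
    refine keyl hab (G := fun n x => (g x * g x) * (ψ1 n x * star (ψ n x)))
      (c := -(ρ₂:ℂ) / k₂) (by simp [h6, h2]) ?_ ?_ hS ?_ ?_ ?_
    · intro n; have := cψ n; fun_prop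
    · intro n; have := cψ n; have := cψ1 n; fun_prop
    · intro n; simp [g0]
    · intro n; simp [gb]
    · intro n x hx
      refine HasDerivAt.congr_deriv ((hd x).fun_mul ((P.dψ1 n x hx).fun_mul
        (P.dψ n x hx).star)) ?_
      simp only [star_add, star_sub, star_neg, star_mul', star_div₀, star_inv₀, star_pow, star_real, star_star, gs]
      field_simp
      ring
  have S6 : Sm 0 b (fun n x => (lam n : ℂ) * g x * w n x) :=
    ((hw.mmul hab Mg).bd.null hab hmu).congr hab fun n x _ => by field_simp [hl n]
  have hZ := ((((((Zo.prod hab S3 S3.star.bd).cmul hab ρ₁).add hab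
    ((Zo.prod hab S2 S2.star.bd).cmul hab k₁)).add hab
    ((Zo.prod hab S5 S5.star.bd).cmul hab ρ₂)).add hab
    ((Zo.prod hab S4 S4.star.bd).cmul hab k₂)).add hab
    ((Zo.prod hab S6 S6.star.bd).cmul hab ρ₁)).add hab
    ((Zo.prod hab S1' S1'.star.bd).cmul hab k₃)
  refine (hZ.int hab).congr fun n => ?_
  apply intervalIntegral.integral_congr
  intro x _
  simp only [En, star_mul', star_real, gs]
  simp only [hg]
  ring
end

lemma extract_Sm {a b : ℝ} (hab : a ≤ b) {g1 g2 g3 g4 g5 g6 : ℕ → ℝ → ℂ} {c1 c2 c3 c4 c5 c6 : ℝ}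
    (h1 : 0 < c1) (h2 : 0 < c2) (h3 : 0 < c3) (h4 : 0 < c4) (h5 : 0 < c5) (h6 : 0 < c6)
    (k1 : ∀ n, ContinuousOn (g1 n) (Icc a b)) (k2 : ∀ n, ContinuousOn (g2 n) (Icc a b))
    (k3 : ∀ n, ContinuousOn (g3 n) (Icc a b)) (k4 : ∀ n, ContinuousOn (g4 n) (Icc a b))
    (k5 : ∀ n, ContinuousOn (g5 n) (Icc a b)) (k6 : ∀ n, ContinuousOn (g6 n) (Icc a b))
    (h : Tendsto (fun n => ∫ x in a..b, (c1 * ‖g1 n x‖ ^ 2 + c2 * ‖g2 n x‖ ^ 2 + c3 * ‖g3 n x‖ ^ 2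
      + c4 * ‖g4 n x‖ ^ 2 + c5 * ‖g5 n x‖ ^ 2 + c6 * ‖g6 n x‖ ^ 2)) atTop (nhds 0)) :
    Sm a b g1 ∧ Sm a b g2 ∧ Sm a b g3 ∧ Sm a b g4 ∧ Sm a b g5 ∧ Sm a b g6 := by
  set T : ℕ → ℝ → ℝ := fun n x => c1 * ‖g1 n x‖ ^ 2 + c2 * ‖g2 n x‖ ^ 2 + c3 * ‖g3 n x‖ ^ 2
      + c4 * ‖g4 n x‖ ^ 2 + c5 * ‖g5 n x‖ ^ 2 + c6 * ‖g6 n x‖ ^ 2 with hT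
  have cT : ∀ n, ContinuousOn (T n) (Icc a b) := by
    intro n
    have := k1 n; have := k2 n; have := k3 n; have := k4 n; have := k5 n; have := k6 n
    simp only [hT]
    fun_prop
  have key : ∀ (c : ℝ) (g : ℕ → ℝ → ℂ), 0 < c → (∀ n, ContinuousOn (g n) (Icc a b)) →
      (∀ n x, c * ‖g n x‖ ^ 2 ≤ T n x) → Sm a b g := by
    intro c g hc hg hle
    refine Sm.of_le hab hg (T := fun n x => c⁻¹ * T n x) (fun n => (cT n).const_smul c⁻¹) ?_ ?_
    · refine Eventually.of_forall fun n x _ => ?_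
      rw [← div_eq_inv_mul, le_div_iff₀ hc, mul_comm]
      exact hle n x
    · have := h.const_mul c⁻¹
      simp only [mul_zero] at this
      exact this.congr fun n => (intervalIntegral.integral_const_mul _ _).symm
  have p1 : ∀ n x, 0 ≤ c1 * ‖g1 n x‖ ^ 2 := fun n x => by positivity
  have p2 : ∀ n x, 0 ≤ c2 * ‖g2 n x‖ ^ 2 := fun n x => by positivity
  have p3 : ∀ n x, 0 ≤ c3 * ‖g3 n x‖ ^ 2 := fun n x => by positivity
  have p4 : ∀ n x, 0 ≤ c4 * ‖g4 n x‖ ^ 2 := fun n x => by positivity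
  have p5 : ∀ n x, 0 ≤ c5 * ‖g5 n x‖ ^ 2 := fun n x => by positivity
  have p6 : ∀ n x, 0 ≤ c6 * ‖g6 n x‖ ^ 2 := fun n x => by positivity
  refine ⟨key _ _ h1 k1 ?_, key _ _ h2 k2 ?_, key _ _ h3 k3 ?_, key _ _ h4 k4 ?_, key _ _ h5 k5 ?_,
    key _ _ h6 k6 ?_⟩ <;>
  · intro n x
    simp only [hT]
    linarith [p1 n x, p2 n x, p3 n x, p4 n x, p5 n x, p6 n x]

lemma extract_Bd {a b : ℝ} (hab : a ≤ b) {g1 g2 g3 g4 g5 g6 : ℕ → ℝ → ℂ} {c1 c2 c3 c4 c5 c6 : ℝ}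
    (h1 : 0 < c1) (h2 : 0 < c2) (h3 : 0 < c3) (h4 : 0 < c4) (h5 : 0 < c5) (h6 : 0 < c6)
    (k1 : ∀ n, ContinuousOn (g1 n) (Icc a b)) (k2 : ∀ n, ContinuousOn (g2 n) (Icc a b))
    (k3 : ∀ n, ContinuousOn (g3 n) (Icc a b)) (k4 : ∀ n, ContinuousOn (g4 n) (Icc a b))
    (k5 : ∀ n, ContinuousOn (g5 n) (Icc a b)) (k6 : ∀ n, ContinuousOn (g6 n) (Icc a b))
    (h : ∀ n, ∫ x in a..b, (c1 * ‖g1 n x‖ ^ 2 + c2 * ‖g2 n x‖ ^ 2 + c3 * ‖g3 n x‖ ^ 2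
      + c4 * ‖g4 n x‖ ^ 2 + c5 * ‖g5 n x‖ ^ 2 + c6 * ‖g6 n x‖ ^ 2) = 1) :
    Bd a b g1 ∧ Bd a b g2 ∧ Bd a b g3 ∧ Bd a b g4 ∧ Bd a b g5 ∧ Bd a b g6 := by
  set T : ℕ → ℝ → ℝ := fun n x => c1 * ‖g1 n x‖ ^ 2 + c2 * ‖g2 n x‖ ^ 2 + c3 * ‖g3 n x‖ ^ 2
      + c4 * ‖g4 n x‖ ^ 2 + c5 * ‖g5 n x‖ ^ 2 + c6 * ‖g6 n x‖ ^ 2 with hT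
  have cT : ∀ n, ContinuousOn (T n) (Icc a b) := by
    intro n
    have := k1 n; have := k2 n; have := k3 n; have := k4 n; have := k5 n; have := k6 n
    simp only [hT]
    fun_prop
  have key : ∀ (c : ℝ) (g : ℕ → ℝ → ℂ), 0 < c → (∀ n, ContinuousOn (g n) (Icc a b)) →
      (∀ n x, c * ‖g n x‖ ^ 2 ≤ T n x) → Bd a b g := by
    intro c g hc hg hle
    refine Bd.of_le hab hg (T := fun n x => c⁻¹ * T n x) (C := c⁻¹ * 1)
      (fun n => (cT n).const_smul c⁻¹) ?_ ?_
    · refine Eventually.of_forall fun n x _ => ?_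
      rw [← div_eq_inv_mul, le_div_iff₀ hc, mul_comm]
      exact hle n x
    · refine Eventually.of_forall fun n => ?_
      rw [intervalIntegral.integral_const_mul, ← h n]
  have p1 : ∀ n x, 0 ≤ c1 * ‖g1 n x‖ ^ 2 := fun n x => by positivity
  have p2 : ∀ n x, 0 ≤ c2 * ‖g2 n x‖ ^ 2 := fun n x => by positivity
  have p3 : ∀ n x, 0 ≤ c3 * ‖g3 n x‖ ^ 2 := fun n x => by positivity
  have p4 : ∀ n x, 0 ≤ c4 * ‖g4 n x‖ ^ 2 := fun n x => by positivity
  have p5 : ∀ n x, 0 ≤ c5 * ‖g5 n x‖ ^ 2 := fun n x => by positivity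
  have p6 : ∀ n x, 0 ≤ c6 * ‖g6 n x‖ ^ 2 := fun n x => by positivity
  refine ⟨key _ _ h1 k1 ?_, key _ _ h2 k2 ?_, key _ _ h3 k3 ?_, key _ _ h4 k4 ?_, key _ _ h5 k5 ?_,
    key _ _ h6 k6 ?_⟩ <;>
  · intro n x
    simp only [hT]
    linarith [p1 n x, p2 n x, p3 n x, p4 n x, p5 n x, p6 n x]

/-- The energy tends to zero on the whole interval. -/
lemma energy_zero {ρ₁ ρ₂ k₁ k₂ k₃ K β L : ℝ} {lam : ℕ → ℝ}
    {φ φ1 ψ ψ1 w w1 R2 R4 R6 R2' R4' R6' : ℕ → ℝ → ℂ} (hβ : 0 < β) (hL : β < L)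
    (P : Piece ρ₁ ρ₂ k₁ k₂ k₃ K 0 β lam φ φ1 ψ ψ1 w w1 R2 R4 R6)
    (Q : Piece ρ₁ ρ₂ k₁ k₂ k₃ K β L lam φ φ1 ψ ψ1 w w1 R2' R4' R6')
    (hne : ∀ n, lam n ≠ 0)
    (hlam : Tendsto (fun n => |lam n|) atTop atTop)
    (hr1 : 0 < ρ₁) (hr2 : 0 < ρ₂)
    (hk1 : 0 < k₁) (hk2 : 0 < k₂) (hk3 : 0 < k₃) (hK : 0 < K) (hsp : k₁ / ρ₁ = k₂ / ρ₂)
    (hw : Sm 0 β (fun n x => (lam n : ℂ) ^ 2 * w n x)) :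
    Tendsto (fun n => ∫ x in (0:ℝ)..L, En ρ₁ ρ₂ k₁ k₂ k₃ lam φ φ1 ψ ψ1 w w1 n x)
      atTop (nhds 0) := by
  have h0 := P.loc_small hβ hne hlam hr1 hr2 hk1 hk2 hk3 hK hsp hw
  have hx : ∀ x : ℝ, HasDerivAt (fun x : ℝ => (x:ℂ)) 1 x := fun x => Complex.ofRealCLM.hasDerivAt
  have e1 := P.energy hβ.le hk1 hk2 hk3
    (q := fun x => (β:ℂ) ^ 2 / 3 * (x:ℂ) ^ 3 - (β:ℂ) / 2 * (x:ℂ) ^ 4 + 1 / 5 * (x:ℂ) ^ 5)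
    (q' := fun x => ((x:ℂ) * ((β:ℂ) - x)) ^ 2)
    (fun x => ((((hx x).fun_pow 3).const_mul _).fun_sub (((hx x).fun_pow 4).const_mul _)
      |>.fun_add (((hx x).fun_pow 5).const_mul _)).congr_deriv (by simp; ring)) (by fun_prop)
  have e2 := P.energy hβ.le hk1 hk2 hk3 (q := fun x => (x:ℂ)) (q' := fun _ => 1) hx (by fun_prop)
  have e3 := Q.energy hL.le hk1 hk2 hk3 (q := fun x => (x:ℂ) - L) (q' := fun _ => 1)
    (fun x => (hx x).sub_const _) (by fun_prop)
  set E := En ρ₁ ρ₂ k₁ k₂ k₃ lam φ φ1 ψ ψ1 w w1 with hE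
  have hEβ : Tendsto (fun n => E n β) atTop (nhds 0) := by
    have := ((e1.add h0).const_mul (30 / (β:ℂ) ^ 5))
    simp only [add_zero, mul_zero] at this
    refine this.congr fun n => ?_
    have : (β:ℂ) ≠ 0 := by exact_mod_cast hβ.ne'
    simp only [Complex.ofReal_zero]
    field_simp
    ring
  have t1 := (hEβ.const_mul (β:ℂ)).sub e2
  have t2 := (hEβ.const_mul ((L:ℂ) - β)).sub e3
  have t3 := t1.add t2
  simp only [add_zero, mul_zero, sub_zero] at t3
  refine t3.congr fun n => ?_
  rw [← intervalIntegral.integral_add_adjacent_intervals (ii_of_cont hβ.le (P.cE n))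
    (ii_of_cont hL.le (Q.cE n))]
  simp only [Complex.ofReal_zero, one_mul, sub_self, zero_mul]
  ring

/-- Dissipation on a subinterval. -/
lemma dissip {ρ₁ ρ₂ k₁ k₂ k₃ l d a b : ℝ} {lam : ℕ → ℝ} (hab : a ≤ b)
    (hk1 : 0 < k₁) (hk2 : 0 < k₂) (hk3 : 0 < k₃) (hne : ∀ n, lam n ≠ 0)
    {φ φ1 ψ ψ1 w w1 f1 g1 f2 f3 g3 f4 f5 g5 f6 S V2 V4 T V6 : ℕ → ℝ → ℂ}
    (eS : ∀ n, S n = fun x => φ1 n x + ψ n x + l * w n x)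
    (eT : ∀ n, T n = fun x => w1 n x - l * φ n x)
    (eV2 : ∀ n, V2 n = fun x => Complex.I * lam n * φ n x - (lam n : ℂ)⁻¹ ^ 2 * f1 n x)
    (eV4 : ∀ n, V4 n = fun x => Complex.I * lam n * ψ n x - (lam n : ℂ)⁻¹ ^ 2 * f3 n x)
    (eV6 : ∀ n, V6 n = fun x => Complex.I * lam n * w n x - (lam n : ℂ)⁻¹ ^ 2 * f5 n x)
    (dφ : ∀ n, ∀ x ∈ Ioo a b, HasDerivAt (φ n) (φ1 n x) x)
    (dψ : ∀ n, ∀ x ∈ Ioo a b, HasDerivAt (ψ n) (ψ1 n x) x)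
    (dw : ∀ n, ∀ x ∈ Ioo a b, HasDerivAt (w n) (w1 n x) x)
    (df1 : ∀ n, ∀ x ∈ Ioo a b, HasDerivAt (f1 n) (g1 n x) x)
    (df3 : ∀ n, ∀ x ∈ Ioo a b, HasDerivAt (f3 n) (g3 n x) x)
    (df5 : ∀ n, ∀ x ∈ Ioo a b, HasDerivAt (f5 n) (g5 n x) x)
    (dS : ∀ n, ∀ x ∈ Ioo a b, HasDerivAt (S n) ((Complex.I * lam n * ρ₁ * V2 n x
      - l * k₃ * T n x - ρ₁ * (lam n : ℂ)⁻¹ ^ 2 * f2 n x) / k₁) x)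
    (dψ1 : ∀ n, ∀ x ∈ Ioo a b, HasDerivAt (ψ1 n) ((Complex.I * lam n * ρ₂ * V4 n x
      + k₁ * S n x - ρ₂ * (lam n : ℂ)⁻¹ ^ 2 * f4 n x) / k₂) x)
    (dT : ∀ n, ∀ x ∈ Ioo a b, HasDerivAt (T n) ((Complex.I * lam n * ρ₁ * V6 n x
      + l * k₁ * S n x + d * V6 n x - ρ₁ * (lam n : ℂ)⁻¹ ^ 2 * f6 n x) / k₃) x)
    (bS : Bd a b S) (bV2 : Bd a b V2) (bψ1 : Bd a b ψ1) (bV4 : Bd a b V4) (bT : Bd a b T)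
    (bV6 : Bd a b V6)
    (s1 : Sm a b (fun n x => g1 n x + f3 n x + l * f5 n x)) (s2 : Sm a b f2) (s3 : Sm a b g3)
    (s4 : Sm a b f4) (s5 : Sm a b (fun n x => g5 n x - l * f1 n x)) (s6 : Sm a b f6)
    {G : ℕ → ℝ → ℂ}
    (eG : ∀ n, G n = fun x => (lam n : ℂ) ^ 2 *
      ((k₁ * (S n x * star (V2 n x)) + k₂ * (ψ1 n x * star (V4 n x)) + k₃ * (T n x * star (V6 n x)))
      + star (k₁ * (S n x * star (V2 n x)) + k₂ * (ψ1 n x * star (V4 n x))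
        + k₃ * (T n x * star (V6 n x))))) :
    Tendsto (fun n => G n b - G n a - ∫ x in a..b, 2 * d * (((lam n : ℂ) * V6 n x)
      * star ((lam n : ℂ) * V6 n x))) atTop (nhds 0) := by
  have h1 : (k₁ : ℂ) ≠ 0 := by exact_mod_cast hk1.ne'
  have h2 : (k₂ : ℂ) ≠ 0 := by exact_mod_cast hk2.ne'
  have h3 : (k₃ : ℂ) ≠ 0 := by exact_mod_cast hk3.ne'
  have hX := (((((Zo.prod hab s2 bV2.star).cmul hab ρ₁).add hab
    ((Zo.prod hab s4 bV4.star).cmul hab ρ₂)).add hab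
    ((Zo.prod hab s6 bV6.star).cmul hab ρ₁)).add hab
    ((Zo.prod hab s1.star bS).cmul hab k₁)).add hab
    ((Zo.prod hab s3.star bψ1).cmul hab k₂) |>.add hab
    ((Zo.prod hab s5.star bT).cmul hab k₃)
  have hS := (hX.add hab hX.star).cmul hab (-1)
  refine ftcz hab ?_ (D := fun n x => 2 * d * (((lam n : ℂ) * V6 n x)
      * star ((lam n : ℂ) * V6 n x))) ?_ hS ?_
  · intro n
    rw [eG]
    have := bS.1 n
    have := bV2.1 n
    have := bV4.1 n
    have := bV6.1 n
    have := bT.1 n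
    have := bψ1.1 n
    fun_prop
  · intro n
    have := bV6.1 n
    fun_prop
  · intro n x hx
    have hl : (lam n : ℂ) ≠ 0 := by exact_mod_cast hne n
    have dV2 : HasDerivAt (V2 n) (Complex.I * lam n * φ1 n x - (lam n : ℂ)⁻¹ ^ 2 * g1 n x) x := by
      rw [eV2]
      exact ((dφ n x hx).const_mul _).fun_sub ((df1 n x hx).const_mul _)
    have dV4 : HasDerivAt (V4 n) (Complex.I * lam n * ψ1 n x - (lam n : ℂ)⁻¹ ^ 2 * g3 n x) x := by
      rw [eV4]
      exact ((dψ n x hx).const_mul _).fun_sub ((df3 n x hx).const_mul _)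
    have dV6 : HasDerivAt (V6 n) (Complex.I * lam n * w1 n x - (lam n : ℂ)⁻¹ ^ 2 * g5 n x) x := by
      rw [eV6]
      exact ((dw n x hx).const_mul _).fun_sub ((df5 n x hx).const_mul _)
    have d0 := ((((dS n x hx).fun_mul dV2.star).const_mul (k₁:ℂ)).fun_add
      (((dψ1 n x hx).fun_mul dV4.star).const_mul (k₂:ℂ))).fun_add
      (((dT n x hx).fun_mul dV6.star).const_mul (k₃:ℂ))
    rw [eG]
    refine HasDerivAt.congr_deriv ((d0.fun_add d0.star).const_mul _) ?_
    have hI : star Complex.I = - Complex.I := by rw [Complex.star_def, Complex.conj_I]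
    have x1 : φ1 n x = S n x - ψ n x - l * w n x := by rw [eS]; ring
    have x2 : w1 n x = T n x + l * φ n x := by rw [eT]; ring
    have x3 : V2 n x = Complex.I * lam n * φ n x - (lam n : ℂ)⁻¹ ^ 2 * f1 n x := by rw [eV2]
    have x4 : V4 n x = Complex.I * lam n * ψ n x - (lam n : ℂ)⁻¹ ^ 2 * f3 n x := by rw [eV4]
    have x6 : V6 n x = Complex.I * lam n * w n x - (lam n : ℂ)⁻¹ ^ 2 * f5 n x := by rw [eV6]
    have y3 : Complex.I * lam n * φ n x = V2 n x + (lam n : ℂ)⁻¹ ^ 2 * f1 n x := by rw [x3]; ring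
    have y4 : Complex.I * lam n * ψ n x = V4 n x + (lam n : ℂ)⁻¹ ^ 2 * f3 n x := by rw [x4]; ring
    have y6 : Complex.I * lam n * w n x = V6 n x + (lam n : ℂ)⁻¹ ^ 2 * f5 n x := by rw [x6]; ring
    have z1 : Complex.I * lam n * φ1 n x = Complex.I * lam n * S n x
        - (V4 n x + (lam n : ℂ)⁻¹ ^ 2 * f3 n x) - l * (V6 n x + (lam n : ℂ)⁻¹ ^ 2 * f5 n x) := by
      rw [← y4, ← y6, x1]; ring
    have z2 : Complex.I * lam n * w1 n x = Complex.I * lam n * T n x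
        + l * (V2 n x + (lam n : ℂ)⁻¹ ^ 2 * f1 n x) := by
      rw [← y3, x2]; ring
    rw [z1, z2]
    clear z1 z2 y3 y4 y6 x1 x2 x3 x4 x6 d0 dV2 dV4 dV6
    simp only [star_add, star_sub, star_neg, star_mul', star_div₀, star_inv₀, star_pow, star_real,
      star_star, hI]
    field_simp
    ring

/-- Smallness of the lower order parts of the right-hand side. -/
lemma rhs_small {l L : ℝ} (hL : 0 < L) {f1 g1 f3 g3 f5 g5 : ℕ → ℝ → ℂ}
    (cf1 : ∀ n, ContinuousOn (f1 n) (Icc 0 L)) (cf3 : ∀ n, ContinuousOn (f3 n) (Icc 0 L))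
    (cf5 : ∀ n, ContinuousOn (f5 n) (Icc 0 L))
    (df1 : ∀ n, ∀ x ∈ Ioo 0 L, HasDerivAt (f1 n) (g1 n x) x)
    (df3 : ∀ n, ∀ x ∈ Ioo 0 L, HasDerivAt (f3 n) (g3 n x) x)
    (df5 : ∀ n, ∀ x ∈ Ioo 0 L, HasDerivAt (f5 n) (g5 n x) x)
    (z1 : ∀ n, f1 n 0 = 0) (z3 : ∀ n, f3 n 0 = 0) (z5 : ∀ n, f5 n 0 = 0)
    (s1 : Sm 0 L (fun n x => g1 n x + f3 n x + l * f5 n x)) (s3 : Sm 0 L g3)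
    (s5 : Sm 0 L (fun n x => g5 n x - l * f1 n x)) :
    Sm 0 L f1 ∧ Sm 0 L f3 ∧ Sm 0 L f5 := by
  have hab := hL.le
  have t3 : Sm 0 L f3 := poinc hab cf3 z3 s3 df3
  set c : ℝ → ℂ := fun x => ((Real.cos (l * x) : ℝ) : ℂ) with hc
  set s : ℝ → ℂ := fun x => ((Real.sin (l * x) : ℝ) : ℂ) with hs
  have dlin : ∀ x : ℝ, HasDerivAt (fun x : ℝ => l * x) l x := fun x => by
    simpa using (hasDerivAt_id x).const_mul l
  have dc : ∀ x, HasDerivAt c (-(l * s x)) x := fun x => by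
    have := ((dlin x).cos).ofReal_comp
    refine this.congr_deriv ?_
    simp only [hs]; push_cast; ring
  have ds : ∀ x, HasDerivAt s (l * c x) x := fun x => by
    have := ((dlin x).sin).ofReal_comp
    refine this.congr_deriv ?_
    simp only [hc]; push_cast; ring
  have cc : Continuous c := by fun_prop
  have cs : Continuous s := by fun_prop
  have Mc : Mb 0 L (fun _ => c) := Mb.fix cc.continuousOn
  have Ms : Mb 0 L (fun _ => s) := Mb.fix cs.continuousOn
  have r1 := s1.add hab (t3.cmul hab (-1))
  have Y : Sm 0 L (fun n x => c x * f1 n x + s x * f5 n x) := by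
    refine poinc hab ?_ ?_ ((r1.mmul hab Mc).add hab (s5.mmul hab Ms)) ?_
    · intro n; have := cf1 n; have := cf5 n; fun_prop
    · intro n; simp [z1, z5]
    · intro n x hx
      refine (((dc x).fun_mul (df1 n x hx)).fun_add ((ds x).fun_mul (df5 n x hx))).congr_deriv ?_
      ring
  have Z : Sm 0 L (fun n x => c x * f5 n x - s x * f1 n x) := by
    refine poinc hab ?_ ?_ ((s5.mmul hab Mc).add hab ((r1.mmul hab Ms).cmul hab (-1))) ?_
    · intro n; have := cf1 n; have := cf5 n; fun_prop
    · intro n; simp [z1, z5]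
    · intro n x hx
      refine (((dc x).fun_mul (df5 n x hx)).fun_sub ((ds x).fun_mul (df1 n x hx))).congr_deriv ?_
      ring
  have cs1 : ∀ x, c x ^ 2 + s x ^ 2 = 1 := by
    intro x
    simp only [hc, hs]
    exact_mod_cast Real.cos_sq_add_sin_sq (l * x)
  refine ⟨((Y.mmul hab Mc).add hab ((Z.mmul hab Ms).cmul hab (-1))).congr hab ?_, t3,
    ((Y.mmul hab Ms).add hab (Z.mmul hab Mc)).congr hab ?_⟩
  · intro n x _
    linear_combination -(f1 n x) * cs1 x
  · intro n x _
    linear_combination -(f5 n x) * cs1 x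

lemma core {ρ₁ ρ₂ k₁ k₂ k₃ l L β a₀ : ℝ}
    (hrho1 : 0 < ρ₁) (hrho2 : 0 < ρ₂) (hk1 : 0 < k₁) (hk2 : 0 < k₂) (hk3 : 0 < k₃)
    (hl : 0 < l) (ha0 : 0 < a₀) (hbeta : 0 < β) (hbetaL : β < L)
    (hspeed : k₁ / ρ₁ = k₂ / ρ₂) {lam : ℕ → ℝ} (hne : ∀ n, lam n ≠ 0)
    (hlam : Tendsto (fun n => |lam n|) atTop atTop)
    {φ φ1 ψ ψ1 w w1 f1 g1 f2 f3 g3 f4 f5 g5 f6 S V2 V4 T V6 : ℕ → ℝ → ℂ}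
    (eS : ∀ n, S n = fun x => φ1 n x + ψ n x + l * w n x)
    (eT : ∀ n, T n = fun x => w1 n x - l * φ n x)
    (eV2 : ∀ n, V2 n = fun x => Complex.I * lam n * φ n x - (lam n : ℂ)⁻¹ ^ 2 * f1 n x)
    (eV4 : ∀ n, V4 n = fun x => Complex.I * lam n * ψ n x - (lam n : ℂ)⁻¹ ^ 2 * f3 n x)
    (eV6 : ∀ n, V6 n = fun x => Complex.I * lam n * w n x - (lam n : ℂ)⁻¹ ^ 2 * f5 n x)
    (cφ : ∀ n, ContinuousOn (φ n) (Icc 0 L)) (cψ : ∀ n, ContinuousOn (ψ n) (Icc 0 L))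
    (cw : ∀ n, ContinuousOn (w n) (Icc 0 L))
    (cf1 : ∀ n, ContinuousOn (f1 n) (Icc 0 L)) (cf3 : ∀ n, ContinuousOn (f3 n) (Icc 0 L))
    (cf5 : ∀ n, ContinuousOn (f5 n) (Icc 0 L))
    (dφ : ∀ n, ∀ x ∈ Ioo 0 L, HasDerivAt (φ n) (φ1 n x) x)
    (dψ : ∀ n, ∀ x ∈ Ioo 0 L, HasDerivAt (ψ n) (ψ1 n x) x)
    (dw : ∀ n, ∀ x ∈ Ioo 0 L, HasDerivAt (w n) (w1 n x) x)
    (df1 : ∀ n, ∀ x ∈ Ioo 0 L, HasDerivAt (f1 n) (g1 n x) x)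
    (df3 : ∀ n, ∀ x ∈ Ioo 0 L, HasDerivAt (f3 n) (g3 n x) x)
    (df5 : ∀ n, ∀ x ∈ Ioo 0 L, HasDerivAt (f5 n) (g5 n x) x)
    (dS : ∀ n, ∀ x ∈ Ioo 0 β ∪ Ioo β L, HasDerivAt (S n) ((Complex.I * lam n * ρ₁ * V2 n x
      - l * k₃ * T n x - ρ₁ * (lam n : ℂ)⁻¹ ^ 2 * f2 n x) / k₁) x)
    (dψ1 : ∀ n, ∀ x ∈ Ioo 0 β ∪ Ioo β L, HasDerivAt (ψ1 n) ((Complex.I * lam n * ρ₂ * V4 n x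
      + k₁ * S n x - ρ₂ * (lam n : ℂ)⁻¹ ^ 2 * f4 n x) / k₂) x)
    (dT : ∀ n, ∀ x ∈ Ioo 0 β, HasDerivAt (T n) ((Complex.I * lam n * ρ₁ * V6 n x
      + l * k₁ * S n x + a₀ * V6 n x - ρ₁ * (lam n : ℂ)⁻¹ ^ 2 * f6 n x) / k₃) x)
    (dT' : ∀ n, ∀ x ∈ Ioo β L, HasDerivAt (T n) ((Complex.I * lam n * ρ₁ * V6 n x
      + l * k₁ * S n x + (0:ℝ) * V6 n x - ρ₁ * (lam n : ℂ)⁻¹ ^ 2 * f6 n x) / k₃) x)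
    (bc0 : ∀ n, φ n 0 = 0 ∧ ψ n 0 = 0 ∧ w n 0 = 0 ∧ f1 n 0 = 0 ∧ f3 n 0 = 0 ∧ f5 n 0 = 0)
    (bcL : ∀ n, φ n L = 0 ∧ ψ n L = 0 ∧ w n L = 0 ∧ f1 n L = 0 ∧ f3 n L = 0 ∧ f5 n L = 0)
    (bS : Bd 0 L S) (bV2 : Bd 0 L V2) (bψ1 : Bd 0 L ψ1) (bV4 : Bd 0 L V4) (bT : Bd 0 L T)
    (bV6 : Bd 0 L V6)
    (s1 : Sm 0 L (fun n x => g1 n x + f3 n x + l * f5 n x)) (s2 : Sm 0 L f2) (s3 : Sm 0 L g3)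
    (s4 : Sm 0 L f4) (s5 : Sm 0 L (fun n x => g5 n x - l * f1 n x)) (s6 : Sm 0 L f6) :
    Sm 0 L S ∧ Sm 0 L V2 ∧ Sm 0 L ψ1 ∧ Sm 0 L V4 ∧ Sm 0 L T ∧ Sm 0 L V6 := by
  have hL : 0 < L := hbeta.trans hbetaL
  have hab := hL.le
  have h1 : (k₁ : ℂ) ≠ 0 := by exact_mod_cast hk1.ne'
  have h2 : (k₂ : ℂ) ≠ 0 := by exact_mod_cast hk2.ne'
  have h3 : (k₃ : ℂ) ≠ 0 := by exact_mod_cast hk3.ne'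
  have hI : Complex.I ^ 2 = -1 := Complex.I_sq
  have hlc : ∀ n, (lam n : ℂ) ≠ 0 := fun n => by exact_mod_cast hne n
  have hmu := lam_inv_tendsto hlam
  have hmu2 : Tendsto (fun n => ((lam n : ℂ))⁻¹ ^ 2) atTop (nhds 0) := by simpa using hmu.pow 2
  have Mmu : ∀ a b, Mb a b (fun n _ => ((lam n : ℂ))⁻¹) := fun a b => Mb.seq hmu
  have Mmu2 : ∀ a b, Mb a b (fun n _ => ((lam n : ℂ))⁻¹ ^ 2) := fun a b => Mb.seq hmu2
  obtain ⟨t1, t3, t5⟩ := rhs_small hL cf1 cf3 cf5 df1 df3 df5 (fun n => (bc0 n).2.2.2.1)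
    (fun n => (bc0 n).2.2.2.2.1) (fun n => (bc0 n).2.2.2.2.2) s1 s3 s5
  have bφ : Bd 0 L (fun n x => (lam n : ℂ) * φ n x) :=
    ((bV2.add hab (t1.bd.mmul hab (Mmu2 0 L))).cmul hab (-Complex.I)).congr hab fun n x _ => by
      simp only [eV2]; linear_combination ((lam n : ℂ) * φ n x) * hI
  have bψ : Bd 0 L (fun n x => (lam n : ℂ) * ψ n x) :=
    ((bV4.add hab (t3.bd.mmul hab (Mmu2 0 L))).cmul hab (-Complex.I)).congr hab fun n x _ => by
      simp only [eV4]; linear_combination ((lam n : ℂ) * ψ n x) * hI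
  have bw : Bd 0 L (fun n x => (lam n : ℂ) * w n x) :=
    ((bV6.add hab (t5.bd.mmul hab (Mmu2 0 L))).cmul hab (-Complex.I)).congr hab fun n x _ => by
      simp only [eV6]; linear_combination ((lam n : ℂ) * w n x) * hI
  have sφ : Sm 0 L φ := (bφ.null hab hmu).congr hab fun n x _ => by field_simp [hlc n]
  have sψ : Sm 0 L ψ := (bψ.null hab hmu).congr hab fun n x _ => by field_simp [hlc n]
  have sw : Sm 0 L w := (bw.null hab hmu).congr hab fun n x _ => by field_simp [hlc n]
  have bφ1 : Bd 0 L φ1 := ((bS.add hab (sψ.bd.cmul hab (-1))).add hab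
    (sw.bd.cmul hab (-(l:ℂ)))).congr hab fun n x _ => by simp only [eS]; ring
  have bw1 : Bd 0 L w1 := (bT.add hab (sφ.bd.cmul hab (l:ℂ))).congr hab fun n x _ => by
    simp only [eT]; ring
  -- dissipation
  have iL : ∀ x ∈ Ioo 0 β, x ∈ Ioo 0 L := fun x hx => ⟨hx.1, hx.2.trans hbetaL⟩
  have iR : ∀ x ∈ Ioo β L, x ∈ Ioo 0 L := fun x hx => ⟨hbeta.trans hx.1, hx.2⟩
  have D1 := dissip (ρ₁ := ρ₁) (ρ₂ := ρ₂) (l := l) (d := a₀) hbeta.le hk1 hk2 hk3 hne eS eT eV2 eV4 eV6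
    (fun n x hx => dφ n x (iL x hx)) (fun n x hx => dψ n x (iL x hx))
    (fun n x hx => dw n x (iL x hx)) (fun n x hx => df1 n x (iL x hx))
    (fun n x hx => df3 n x (iL x hx)) (fun n x hx => df5 n x (iL x hx))
    (fun n x hx => dS n x (Or.inl hx)) (fun n x hx => dψ1 n x (Or.inl hx)) dT
    (bS.sub le_rfl hbeta.le hbetaL.le) (bV2.sub le_rfl hbeta.le hbetaL.le)
    (bψ1.sub le_rfl hbeta.le hbetaL.le) (bV4.sub le_rfl hbeta.le hbetaL.le)
    (bT.sub le_rfl hbeta.le hbetaL.le) (bV6.sub le_rfl hbeta.le hbetaL.le)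
    (s1.sub le_rfl hbeta.le hbetaL.le) (s2.sub le_rfl hbeta.le hbetaL.le)
    (s3.sub le_rfl hbeta.le hbetaL.le) (s4.sub le_rfl hbeta.le hbetaL.le)
    (s5.sub le_rfl hbeta.le hbetaL.le) (s6.sub le_rfl hbeta.le hbetaL.le) (fun n => rfl)
  have D2 := dissip (ρ₁ := ρ₁) (ρ₂ := ρ₂) (l := l) (d := 0) hbetaL.le hk1 hk2 hk3 hne eS eT eV2 eV4 eV6
    (fun n x hx => dφ n x (iR x hx)) (fun n x hx => dψ n x (iR x hx))
    (fun n x hx => dw n x (iR x hx)) (fun n x hx => df1 n x (iR x hx))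
    (fun n x hx => df3 n x (iR x hx)) (fun n x hx => df5 n x (iR x hx))
    (fun n x hx => dS n x (Or.inr hx)) (fun n x hx => dψ1 n x (Or.inr hx)) dT'
    (bS.sub hbeta.le hbetaL.le le_rfl) (bV2.sub hbeta.le hbetaL.le le_rfl)
    (bψ1.sub hbeta.le hbetaL.le le_rfl) (bV4.sub hbeta.le hbetaL.le le_rfl)
    (bT.sub hbeta.le hbetaL.le le_rfl) (bV6.sub hbeta.le hbetaL.le le_rfl)
    (s1.sub hbeta.le hbetaL.le le_rfl) (s2.sub hbeta.le hbetaL.le le_rfl)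
    (s3.sub hbeta.le hbetaL.le le_rfl) (s4.sub hbeta.le hbetaL.le le_rfl)
    (s5.sub hbeta.le hbetaL.le le_rfl) (s6.sub hbeta.le hbetaL.le le_rfl) (fun n => rfl)
  have V20 : ∀ n, V2 n 0 = 0 := fun n => by simp [eV2, bc0]
  have V40 : ∀ n, V4 n 0 = 0 := fun n => by simp [eV4, bc0]
  have V60 : ∀ n, V6 n 0 = 0 := fun n => by simp [eV6, bc0]
  have V2L : ∀ n, V2 n L = 0 := fun n => by simp [eV2, bcL]
  have V4L : ∀ n, V4 n L = 0 := fun n => by simp [eV4, bcL]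
  have V6L : ∀ n, V6 n L = 0 := fun n => by simp [eV6, bcL]
  have lV6 : Sm 0 β (fun n x => (lam n : ℂ) * V6 n x) := by
    refine ⟨fun n => continuousOn_const.mul ((bV6.sub le_rfl hbeta.le hbetaL.le).1 n), ?_⟩
    have D := ((D1.add D2).const_mul ((2 * a₀ : ℂ)⁻¹)).norm
    simp only [add_zero, mul_zero, norm_zero] at D
    refine D.congr fun n => ?_
    simp only [V20, V40, V60, V2L, V4L, V6L, star_zero, mul_zero, add_zero, Complex.ofReal_zero,
      zero_mul, intervalIntegral.integral_zero]
    rw [intervalIntegral.integral_const_mul]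
    simp only [star_mul_self_eq]
    rw [intervalIntegral.integral_ofReal]
    have ha : (a₀:ℂ) ≠ 0 := by exact_mod_cast ha0.ne'
    set J := ∫ x in (0:ℝ)..β, ‖(lam n : ℂ) * V6 n x‖ ^ 2 with hJ
    have hJ0 : 0 ≤ J := int_nn hbeta.le fun x _ => by positivity
    have : ∀ z : ℂ, (2 * (a₀:ℂ))⁻¹ * (z - 0 - 2 * a₀ * (J:ℂ) + (0 - z - 0)) = -(J:ℂ) := by
      intro z; field_simp; ring
    rw [this, norm_neg, Complex.norm_real, Real.norm_eq_abs, abs_of_nonneg hJ0]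
  have hw2 : Sm 0 β (fun n x => (lam n : ℂ) ^ 2 * w n x) :=
    ((lV6.add hbeta.le ((t5.sub le_rfl hbeta.le hbetaL.le).mmul hbeta.le (Mmu 0 β))).cmul hbeta.le
      (-Complex.I)).congr hbeta.le fun n x _ => by
        have := hlc n
        simp only [eV6]
        field_simp
        linear_combination ((lam n : ℂ) ^ 3 * w n x) * hI
  -- the pieces
  have q2 : Sm 0 L (fun n x => (l ^ 2 * k₃ : ℂ) * φ n x + -(ρ₁:ℂ) * ((lam n : ℂ)⁻¹ ^ 2 * f2 n x)
      + -(Complex.I * ρ₁) * ((lam n : ℂ)⁻¹ * f1 n x)) :=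
    ((sφ.cmul hab _).add hab ((s2.mmul hab (Mmu2 0 L)).cmul hab _)).add hab
      ((t1.mmul hab (Mmu 0 L)).cmul hab _)
  have q4 : Sm 0 L (fun n x => (k₁ : ℂ) * (ψ n x + l * w n x)
      + -(ρ₂:ℂ) * ((lam n : ℂ)⁻¹ ^ 2 * f4 n x)
      + -(Complex.I * ρ₂) * ((lam n : ℂ)⁻¹ * f3 n x)) :=
    (((sψ.add hab (sw.cmul hab _)).cmul hab _).add hab ((s4.mmul hab (Mmu2 0 L)).cmul hab _)).add
      hab ((t3.mmul hab (Mmu 0 L)).cmul hab _)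
  have q6 : Sm 0 L (fun n x => (l * k₁ : ℂ) * (ψ n x + l * w n x)
      + -(ρ₁:ℂ) * ((lam n : ℂ)⁻¹ ^ 2 * f6 n x)
      + -(Complex.I * ρ₁) * ((lam n : ℂ)⁻¹ * f5 n x)) :=
    (((sψ.add hab (sw.cmul hab _)).cmul hab _).add hab ((s6.mmul hab (Mmu2 0 L)).cmul hab _)).add
      hab ((t5.mmul hab (Mmu 0 L)).cmul hab _)
  have sV6 : Sm 0 β V6 := (lV6.bd.null hbeta.le hmu).congr hbeta.le fun n x _ => by
    field_simp [hlc n]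
  have q6' := (q6.sub le_rfl hbeta.le hbetaL.le).add hbeta.le (sV6.cmul hbeta.le (a₀:ℂ))
  have eφ1 : ∀ n, φ1 n = fun x => S n x - ψ n x - l * w n x := fun n => by
    funext x; rw [eS]; ring
  have ew1 : ∀ n, w1 n = fun x => T n x + l * φ n x := fun n => by
    funext x; rw [eT]; ring
  have dφ1 : ∀ n, ∀ x ∈ Ioo 0 β ∪ Ioo β L, HasDerivAt (φ1 n)
    ((-(lam n : ℂ) ^ 2 * ρ₁ * φ n x - k₁ * ψ1 n x - (l * (k₁ + k₃) : ℝ) * w1 n x +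
      ((l ^ 2 * k₃ : ℂ) * φ n x + -(ρ₁:ℂ) * ((lam n : ℂ)⁻¹ ^ 2 * f2 n x)
      + -(Complex.I * ρ₁) * ((lam n : ℂ)⁻¹ * f1 n x))) / k₁) x := by
    intro n x hx
    have hx' : x ∈ Ioo 0 L := hx.elim (iL x) (iR x)
    have := hlc n
    have h := ((dS n x hx).fun_sub (dψ n x hx')).fun_sub ((dw n x hx').const_mul (l:ℂ))
    rw [← eφ1] at h
    refine h.congr_deriv ?_
    simp only [eV2, eT]
    push_cast
    field_simp
    linear_combination ((lam n : ℂ) ^ 4 * ρ₁ * φ n x) * hI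
  have dψ1' : ∀ n, ∀ x ∈ Ioo 0 β ∪ Ioo β L, HasDerivAt (ψ1 n)
    ((-(lam n : ℂ) ^ 2 * ρ₂ * ψ n x + k₁ * φ1 n x +
      ((k₁ : ℂ) * (ψ n x + l * w n x)
      + -(ρ₂:ℂ) * ((lam n : ℂ)⁻¹ ^ 2 * f4 n x)
      + -(Complex.I * ρ₂) * ((lam n : ℂ)⁻¹ * f3 n x))) / k₂) x := by
    intro n x hx
    have := hlc n
    refine (dψ1 n x hx).congr_deriv ?_
    simp only [eV4, eS]
    field_simp
    linear_combination ((lam n : ℂ) ^ 4 * ρ₂ * ψ n x) * hI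
  have dw1 : ∀ n, ∀ x ∈ Ioo 0 β, HasDerivAt (w1 n)
    ((-(lam n : ℂ) ^ 2 * ρ₁ * w n x + (l * (k₁ + k₃) : ℝ) * φ1 n x +
      ((l * k₁ : ℂ) * (ψ n x + l * w n x)
      + -(ρ₁:ℂ) * ((lam n : ℂ)⁻¹ ^ 2 * f6 n x)
      + -(Complex.I * ρ₁) * ((lam n : ℂ)⁻¹ * f5 n x) + a₀ * V6 n x)) / k₃) x := by
    intro n x hx
    have := hlc n
    have h := (dT n x hx).fun_add ((dφ n x (iL x hx)).const_mul (l:ℂ))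
    rw [← ew1] at h
    refine h.congr_deriv ?_
    simp only [eV6, eS]
    push_cast
    field_simp
    linear_combination ((lam n : ℂ) ^ 4 * ρ₁ * w n x) * hI
  have dw1' : ∀ n, ∀ x ∈ Ioo β L, HasDerivAt (w1 n)
    ((-(lam n : ℂ) ^ 2 * ρ₁ * w n x + (l * (k₁ + k₃) : ℝ) * φ1 n x +
      ((l * k₁ : ℂ) * (ψ n x + l * w n x)
      + -(ρ₁:ℂ) * ((lam n : ℂ)⁻¹ ^ 2 * f6 n x)
      + -(Complex.I * ρ₁) * ((lam n : ℂ)⁻¹ * f5 n x))) / k₃) x := by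
    intro n x hx
    have := hlc n
    have h := (dT' n x hx).fun_add ((dφ n x (iR x hx)).const_mul (l:ℂ))
    rw [← ew1] at h
    refine h.congr_deriv ?_
    simp only [eV6, eS]
    push_cast
    field_simp
    linear_combination ((lam n : ℂ) ^ 4 * ρ₁ * w n x) * hI
  have sL : Icc 0 β ⊆ Icc 0 L := Icc_subset_Icc_right hbetaL.le
  have sR : Icc β L ⊆ Icc 0 L := Icc_subset_Icc_left hbeta.le
  have P : Piece ρ₁ ρ₂ k₁ k₂ k₃ (l * (k₁ + k₃)) 0 β lam φ φ1 ψ ψ1 w w1 _ _ _ :=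
    { cφ := fun n => (cφ n).mono sL
      cψ := fun n => (cψ n).mono sL
      cw := fun n => (cw n).mono sL
      bφ := bφ.sub le_rfl hbeta.le hbetaL.le
      bψ := bψ.sub le_rfl hbeta.le hbetaL.le
      bw := bw.sub le_rfl hbeta.le hbetaL.le
      bφ1 := bφ1.sub le_rfl hbeta.le hbetaL.le
      bψ1 := bψ1.sub le_rfl hbeta.le hbetaL.le
      bw1 := bw1.sub le_rfl hbeta.le hbetaL.le
      s2 := q2.sub le_rfl hbeta.le hbetaL.le
      s4 := q4.sub le_rfl hbeta.le hbetaL.le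
      s6 := q6'
      dφ := fun n x hx => dφ n x (iL x hx)
      dψ := fun n x hx => dψ n x (iL x hx)
      dw := fun n x hx => dw n x (iL x hx)
      dφ1 := fun n x hx => dφ1 n x (Or.inl hx)
      dψ1 := fun n x hx => dψ1' n x (Or.inl hx)
      dw1 := dw1 }
  have Q : Piece ρ₁ ρ₂ k₁ k₂ k₃ (l * (k₁ + k₃)) β L lam φ φ1 ψ ψ1 w w1 _ _ _ :=
    { cφ := fun n => (cφ n).mono sR
      cψ := fun n => (cψ n).mono sR
      cw := fun n => (cw n).mono sR
      bφ := bφ.sub hbeta.le hbetaL.le le_rfl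
      bψ := bψ.sub hbeta.le hbetaL.le le_rfl
      bw := bw.sub hbeta.le hbetaL.le le_rfl
      bφ1 := bφ1.sub hbeta.le hbetaL.le le_rfl
      bψ1 := bψ1.sub hbeta.le hbetaL.le le_rfl
      bw1 := bw1.sub hbeta.le hbetaL.le le_rfl
      s2 := q2.sub hbeta.le hbetaL.le le_rfl
      s4 := q4.sub hbeta.le hbetaL.le le_rfl
      s6 := q6.sub hbeta.le hbetaL.le le_rfl
      dφ := fun n x hx => dφ n x (iR x hx)
      dψ := fun n x hx => dψ n x (iR x hx)
      dw := fun n x hx => dw n x (iR x hx)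
      dφ1 := fun n x hx => dφ1 n x (Or.inr hx)
      dψ1 := fun n x hx => dψ1' n x (Or.inr hx)
      dw1 := dw1' }
  have hE := energy_zero hbeta hbetaL P Q hne hlam hrho1 hrho2 hk1 hk2 hk3 (by positivity) hspeed hw2
  have hE' := extract_Sm hab (g1 := fun n x => (lam n : ℂ) * φ n x) (g2 := φ1)
    (g3 := fun n x => (lam n : ℂ) * ψ n x) (g4 := ψ1) (g5 := fun n x => (lam n : ℂ) * w n x)
    (g6 := w1) hrho1 hk1 hrho2 hk2 hrho1 hk3 bφ.1 bφ1.1 bψ.1 bψ1.1 bw.1 bw1.1 (by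
      have := (Complex.continuous_re.tendsto 0).comp hE
      simp only [Complex.zero_re] at this
      refine this.congr fun n => ?_
      simp only [Function.comp]
      have e : ∀ x, En ρ₁ ρ₂ k₁ k₂ k₃ lam φ φ1 ψ ψ1 w w1 n x =
          ((ρ₁ * ‖(lam n : ℂ) * φ n x‖ ^ 2 + k₁ * ‖φ1 n x‖ ^ 2 + ρ₂ * ‖(lam n : ℂ) * ψ n x‖ ^ 2
          + k₂ * ‖ψ1 n x‖ ^ 2 + ρ₁ * ‖(lam n : ℂ) * w n x‖ ^ 2 + k₃ * ‖w1 n x‖ ^ 2 : ℝ) : ℂ) := by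
        intro x
        rw [Complex.ofReal_add, Complex.ofReal_add, Complex.ofReal_add, Complex.ofReal_add,
          Complex.ofReal_add, Complex.ofReal_mul, Complex.ofReal_mul, Complex.ofReal_mul,
          Complex.ofReal_mul, Complex.ofReal_mul, Complex.ofReal_mul]
        simp only [← star_mul_self_eq, En, star_mul', star_real]
        ring
      simp only [e]
      rw [intervalIntegral.integral_ofReal, Complex.ofReal_re])
  obtain ⟨y1, y2, y3, y4, y5, y6⟩ := hE'
  refine ⟨?_, ?_, y4, ?_, ?_, ?_⟩
  · exact ((y2.add hab sψ).add hab (sw.cmul hab (l:ℂ))).congr hab fun n x _ => by rw [eS]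
  · exact ((y1.cmul hab Complex.I).add hab ((t1.mmul hab (Mmu2 0 L)).cmul hab (-1))).congr hab
      fun n x _ => by rw [eV2]; ring
  · exact ((y3.cmul hab Complex.I).add hab ((t3.mmul hab (Mmu2 0 L)).cmul hab (-1))).congr hab
      fun n x _ => by rw [eV4]; ring
  · exact (y6.add hab (sφ.cmul hab (-(l:ℂ)))).congr hab fun n x _ => by rw [eT]; ring
  · exact ((y5.cmul hab Complex.I).add hab ((t5.mmul hab (Mmu2 0 L)).cmul hab (-1))).congr hab
      fun n x _ => by rw [eV6]; ring

lemma c1_ext {a b : ℝ} (hab : a < b) {v : ℝ → ℂ} (hv : ContDiffOn ℝ 1 v (Icc a b)) :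
    ∃ p : ℝ → ℂ, ContinuousOn p (Icc a b) ∧ ∀ x ∈ Ioo a b, HasDerivAt v (p x) x := by
  refine ⟨derivWithin v (Icc a b), hv.continuousOn_derivWithin (uniqueDiffOn_Icc hab) le_rfl, ?_⟩
  intro x hx
  have h := ((hv.differentiableOn one_ne_zero) x (Ioo_subset_Icc_self hx)).hasDerivWithinAt
  exact h.hasDerivAt (Icc_mem_nhds hx.1 hx.2)

lemma c2_deriv {a b : ℝ} {v p : ℝ → ℂ} (hv : ContDiffOn ℝ 2 v (Icc a b))
    (hp : ∀ x ∈ Ioo a b, HasDerivAt v (p x) x) : ∀ x ∈ Ioo a b, DifferentiableAt ℝ p x := by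
  intro x hx
  have h1 : ContDiffOn ℝ 2 v (Ioo a b) := hv.mono Ioo_subset_Icc_self
  have h2 : ContDiffOn ℝ 1 (deriv v) (Ioo a b) :=
    ((contDiffOn_succ_iff_deriv_of_isOpen (n := 1) isOpen_Ioo).1 h1).2.2
  have h3 : DifferentiableAt ℝ (deriv v) x :=
    (h2.differentiableOn one_ne_zero).differentiableAt (Ioo_mem_nhds hx.1 hx.2)
  refine h3.congr_of_eventuallyEq ?_
  filter_upwards [Ioo_mem_nhds hx.1 hx.2] with y hy using (hp y hy).deriv.symm

lemma sum_contra {a b : ℝ} (hab : a ≤ b) {g1 g2 g3 g4 g5 g6 : ℕ → ℝ → ℂ} {c1 c2 c3 c4 c5 c6 : ℝ}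
    (s1 : Sm a b g1) (s2 : Sm a b g2) (s3 : Sm a b g3) (s4 : Sm a b g4) (s5 : Sm a b g5)
    (s6 : Sm a b g6)
    (h : ∀ n, ∫ x in a..b, (c1 * ‖g1 n x‖ ^ 2 + c2 * ‖g2 n x‖ ^ 2 + c3 * ‖g3 n x‖ ^ 2
      + c4 * ‖g4 n x‖ ^ 2 + c5 * ‖g5 n x‖ ^ 2 + c6 * ‖g6 n x‖ ^ 2) = 1) : False := by
  have ci : ∀ {g : ℕ → ℝ → ℂ} (c : ℝ), Sm a b g → ∀ n,
      IntervalIntegrable (fun x => c * ‖g n x‖ ^ 2) volume a b := fun c hg n =>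
    ii_of_cont hab (((hg.1 n).norm.pow 2).const_smul c)
  have e : ∀ n, c1 * (∫ x in a..b, ‖g1 n x‖ ^ 2) + c2 * (∫ x in a..b, ‖g2 n x‖ ^ 2)
      + c3 * (∫ x in a..b, ‖g3 n x‖ ^ 2) + c4 * (∫ x in a..b, ‖g4 n x‖ ^ 2)
      + c5 * (∫ x in a..b, ‖g5 n x‖ ^ 2) + c6 * (∫ x in a..b, ‖g6 n x‖ ^ 2) = 1 := by
    intro n
    have i1 := ci c1 s1 n
    have i2 := i1.add (ci c2 s2 n)
    have i3 := i2.add (ci c3 s3 n)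
    have i4 := i3.add (ci c4 s4 n)
    have i5 := i4.add (ci c5 s5 n)
    rw [← h n, intervalIntegral.integral_add i5 (ci c6 s6 n),
      intervalIntegral.integral_add i4 (ci c5 s5 n),
      intervalIntegral.integral_add i3 (ci c4 s4 n),
      intervalIntegral.integral_add i2 (ci c3 s3 n),
      intervalIntegral.integral_add i1 (ci c2 s2 n)]
    simp only [intervalIntegral.integral_const_mul]
  have t := (((((s1.2.const_mul c1).add (s2.2.const_mul c2)).add (s3.2.const_mul c3)).add
    (s4.2.const_mul c4)).add (s5.2.const_mul c5)).add (s6.2.const_mul c6)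
  simp only [e, mul_zero, add_zero] at t
  exact one_ne_zero (tendsto_nhds_unique tendsto_const_nhds t)

lemma int_congr_pieces {L β : ℝ} (hL : 0 ≤ L) {F G : ℝ → ℝ}
    (h : ∀ x ∈ Ioo 0 β ∪ Ioo β L, F x = G x) :
    ∫ x in (0:ℝ)..L, F x = ∫ x in (0:ℝ)..L, G x := by
  refine intervalIntegral.integral_congr_ae ?_
  have hn : ∀ᵐ x : ℝ, x ≠ β := by simp [ae_iff, measure_singleton]
  have hn' : ∀ᵐ x : ℝ, x ≠ L := by simp [ae_iff, measure_singleton]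
  filter_upwards [hn, hn'] with x h1 h2 hx
  rw [uIoc_of_le hL] at hx
  apply h
  rcases lt_or_gt_of_ne h1 with h3 | h3
  · exact Or.inl ⟨hx.1, h3⟩
  · exact Or.inr ⟨h3, lt_of_le_of_ne hx.2 h2⟩

/-- Frequency-domain criterion ‖(iλ−𝒜)⁻¹‖ = O(λ²): no resolvent sequence with ℓ = 2 exists. -/
theorem bresse_polynomial_stability_criterion_eq (ρ₁ ρ₂ k₁ k₂ k₃ l L β a₀ : ℝ)
    (hrho1 : 0 < ρ₁) (hrho2 : 0 < ρ₂) (hk1 : 0 < k₁) (hk2 : 0 < k₂) (hk3 : 0 < k₃)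
    (hl : 0 < l) (hL : 0 < L) (ha0 : 0 < a₀) (hbeta : 0 < β) (hbetaL : β < L)
    (hspeed : k₁ / ρ₁ = k₂ / ρ₂) (hk : k₁ ≠ k₃) :
    IsEmpty (BresseSetting ρ₁ ρ₂ k₁ k₂ k₃ l L β a₀ 2) := by
  refine ⟨fun D => ?_⟩
  obtain ⟨lam, v1, v2, v3, v4, v5, v6, f1, f2, f3, f4, f5, f6, hne, hlam, rv1, rv3, rv5, rv5l, rv5r,
    rv2, rv4, rv6, rf1, rf3, rf5, rf2, rf4, rf6, bc0, bcL, q1, q2, q3, q4, q5, q6, nU, nF⟩ := D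
  have h12 : (1 : WithTop ℕ∞) ≤ 2 := one_le_two
  choose φ1 cφ1 dφ1 using fun n => c1_ext hL ((rv1 n).of_le h12)
  choose ψ1 cψ1 dψ1 using fun n => c1_ext hL ((rv3 n).of_le h12)
  choose w1 cw1 dw1 using fun n => c1_ext hL (rv5 n)
  choose g1 cg1 dg1 using fun n => c1_ext hL (rf1 n)
  choose g3 cg3 dg3 using fun n => c1_ext hL (rf3 n)
  choose g5 cg5 dg5 using fun n => c1_ext hL (rf5 n)
  have sub : ∀ x ∈ Ioo (0:ℝ) β ∪ Ioo β L, x ∈ Ioo 0 L := by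
    rintro x (hx | hx)
    · exact ⟨hx.1, hx.2.trans hbetaL⟩
    · exact ⟨hbeta.trans hx.1, hx.2⟩
  have hop : ∀ x ∈ Ioo (0:ℝ) L, Ioo (0:ℝ) L ∈ nhds x := fun x hx => Ioo_mem_nhds hx.1 hx.2
  have hz : ∀ n, (lam n : ℂ) ^ (-((2 : ℕ) : ℤ)) = (lam n : ℂ)⁻¹ ^ 2 := fun n => by
    rw [zpow_neg, zpow_natCast, inv_pow]
  have ddφ : ∀ n, ∀ x ∈ Ioo (0:ℝ) L, DifferentiableAt ℝ (φ1 n) x := fun n =>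
    c2_deriv (rv1 n) (dφ1 n)
  have ddψ : ∀ n, ∀ x ∈ Ioo (0:ℝ) L, DifferentiableAt ℝ (ψ1 n) x := fun n =>
    c2_deriv (rv3 n) (dψ1 n)
  have ddw : ∀ n, ∀ x ∈ Ioo (0:ℝ) β ∪ Ioo β L, DifferentiableAt ℝ (w1 n) x := by
    rintro n x (hx | hx)
    · exact c2_deriv (rv5l n) (fun y hy => dw1 n y (sub y (Or.inl hy))) x hx
    · exact c2_deriv (rv5r n) (fun y hy => dw1 n y (sub y (Or.inr hy))) x hx
  have h1 : (k₁ : ℂ) ≠ 0 := by exact_mod_cast hk1.ne'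
  have h2 : (k₂ : ℂ) ≠ 0 := by exact_mod_cast hk2.ne'
  have h3 : (k₃ : ℂ) ≠ 0 := by exact_mod_cast hk3.ne'
  let S : ℕ → ℝ → ℂ := fun n x => φ1 n x + v3 n x + l * v5 n x
  let T : ℕ → ℝ → ℂ := fun n x => w1 n x - l * v1 n x
  let V2 : ℕ → ℝ → ℂ := fun n x => Complex.I * lam n * v1 n x - (lam n : ℂ)⁻¹ ^ 2 * f1 n x
  let V4 : ℕ → ℝ → ℂ := fun n x => Complex.I * lam n * v3 n x - (lam n : ℂ)⁻¹ ^ 2 * f3 n x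
  let V6 : ℕ → ℝ → ℂ := fun n x => Complex.I * lam n * v5 n x - (lam n : ℂ)⁻¹ ^ 2 * f5 n x
  have e2 : ∀ n, ∀ x ∈ Ioo (0:ℝ) β ∪ Ioo β L, v2 n x = V2 n x := by
    intro n x hx
    have := q1 n x hx
    rw [hz] at this
    simp only [V2]
    linear_combination -this
  have e4 : ∀ n, ∀ x ∈ Ioo (0:ℝ) β ∪ Ioo β L, v4 n x = V4 n x := by
    intro n x hx
    have := q3 n x hx
    rw [hz] at this
    simp only [V4]
    linear_combination -this
  have e6 : ∀ n, ∀ x ∈ Ioo (0:ℝ) β ∪ Ioo β L, v6 n x = V6 n x := by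
    intro n x hx
    have := q5 n x hx
    rw [hz] at this
    simp only [V6]
    linear_combination -this
  have dS : ∀ n, ∀ x ∈ Ioo 0 β ∪ Ioo β L, HasDerivAt (S n) ((Complex.I * lam n * ρ₁ * V2 n x
      - l * k₃ * T n x - ρ₁ * (lam n : ℂ)⁻¹ ^ 2 * f2 n x) / k₁) x := by
    intro n x hx
    have hx' := sub x hx
    have hd : DifferentiableAt ℝ (S n) x :=
      ((ddφ n x hx').add (dψ1 n x hx').differentiableAt).add
        ((dw1 n x hx').differentiableAt.const_mul (l : ℂ))
    have he : deriv (fun y => deriv (v1 n) y + v3 n y + (l : ℂ) * v5 n y) x = deriv (S n) x := by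
      apply Filter.EventuallyEq.deriv_eq
      filter_upwards [hop x hx'] with y hy
      simp only [S, (dφ1 n y hy).deriv]
    have hq := q2 n x hx
    rw [hz, he, e2 n x hx, (dw1 n x hx').deriv] at hq
    refine hd.hasDerivAt.congr_deriv ?_
    rw [eq_div_iff h1]
    simp only [T]
    linear_combination -hq
  have dP : ∀ n, ∀ x ∈ Ioo 0 β ∪ Ioo β L, HasDerivAt (ψ1 n) ((Complex.I * lam n * ρ₂ * V4 n x
      + k₁ * S n x - ρ₂ * (lam n : ℂ)⁻¹ ^ 2 * f4 n x) / k₂) x := by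
    intro n x hx
    have hx' := sub x hx
    have he : deriv (deriv (v3 n)) x = deriv (ψ1 n) x := by
      apply Filter.EventuallyEq.deriv_eq
      filter_upwards [hop x hx'] with y hy
      exact (dψ1 n y hy).deriv
    have hq := q4 n x hx
    rw [hz, he, e4 n x hx, (dφ1 n x hx').deriv] at hq
    refine (ddψ n x hx').hasDerivAt.congr_deriv ?_
    rw [eq_div_iff h2]
    simp only [S]
    linear_combination -hq
  have dT : ∀ n, ∀ x ∈ Ioo 0 β ∪ Ioo β L, HasDerivAt (T n) ((Complex.I * lam n * ρ₁ * V6 n x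
      + l * k₁ * S n x + (if x < β then (a₀ : ℂ) else 0) * V6 n x
      - ρ₁ * (lam n : ℂ)⁻¹ ^ 2 * f6 n x) / k₃) x := by
    intro n x hx
    have hx' := sub x hx
    have hd : DifferentiableAt ℝ (T n) x :=
      (ddw n x hx).sub ((dφ1 n x hx').differentiableAt.const_mul (l : ℂ))
    have he : deriv (fun y => deriv (v5 n) y - (l : ℂ) * v1 n y) x = deriv (T n) x := by
      apply Filter.EventuallyEq.deriv_eq
      filter_upwards [hop x hx'] with y hy
      simp only [T, (dw1 n y hy).deriv]
    have hq := q6 n x hx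
    rw [hz, he, e6 n x hx, (dφ1 n x hx').deriv] at hq
    refine hd.hasDerivAt.congr_deriv ?_
    rw [eq_div_iff h3]
    simp only [S]
    linear_combination -hq
  have c1 := fun n => (rv1 n).continuousOn
  have c3 := fun n => (rv3 n).continuousOn
  have c5 := fun n => (rv5 n).continuousOn
  have k1 := fun n => (rf1 n).continuousOn
  have k3 := fun n => (rf3 n).continuousOn
  have k5 := fun n => (rf5 n).continuousOn
  have cS : ∀ n, ContinuousOn (S n) (Icc 0 L) := fun n =>
    ((cφ1 n).add (c3 n)).add (continuousOn_const.mul (c5 n))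
  have cT : ∀ n, ContinuousOn (T n) (Icc 0 L) := fun n =>
    (cw1 n).sub (continuousOn_const.mul (c1 n))
  have cV2 : ∀ n, ContinuousOn (V2 n) (Icc 0 L) := fun n =>
    (continuousOn_const.mul (c1 n)).sub (continuousOn_const.mul (k1 n))
  have cV4 : ∀ n, ContinuousOn (V4 n) (Icc 0 L) := fun n =>
    (continuousOn_const.mul (c3 n)).sub (continuousOn_const.mul (k3 n))
  have cV6 : ∀ n, ContinuousOn (V6 n) (Icc 0 L) := fun n =>
    (continuousOn_const.mul (c5 n)).sub (continuousOn_const.mul (k5 n))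
  have nU' : ∀ n, ∫ x in (0:ℝ)..L, (k₁ * ‖S n x‖ ^ 2 + ρ₁ * ‖V2 n x‖ ^ 2 + k₂ * ‖ψ1 n x‖ ^ 2
      + ρ₂ * ‖V4 n x‖ ^ 2 + k₃ * ‖T n x‖ ^ 2 + ρ₁ * ‖V6 n x‖ ^ 2) = 1 := by
    intro n
    rw [← nU n]
    refine int_congr_pieces (β := β) hL.le fun x hx => ?_
    have hx' := sub x hx
    rw [(dφ1 n x hx').deriv, (dψ1 n x hx').deriv, (dw1 n x hx').deriv, e2 n x hx, e4 n x hx,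
      e6 n x hx]
  have nF' : Tendsto (fun n => ∫ x in (0:ℝ)..L, (k₁ * ‖g1 n x + f3 n x + l * f5 n x‖ ^ 2
      + ρ₁ * ‖f2 n x‖ ^ 2 + k₂ * ‖g3 n x‖ ^ 2 + ρ₂ * ‖f4 n x‖ ^ 2
      + k₃ * ‖g5 n x - l * f1 n x‖ ^ 2 + ρ₁ * ‖f6 n x‖ ^ 2)) atTop (nhds 0) := by
    refine nF.congr fun n => ?_
    refine int_congr_pieces (β := β) hL.le fun x hx => ?_
    have hx' := sub x hx
    rw [(dg1 n x hx').deriv, (dg3 n x hx').deriv, (dg5 n x hx').deriv]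
  obtain ⟨bS, bV2, bψ1, bV4, bT, bV6⟩ := extract_Bd hL.le hk1 hrho1 hk2 hrho2 hk3 hrho1
    cS cV2 cψ1 cV4 cT cV6 nU'
  obtain ⟨s1, s2, s3, s4, s5, s6⟩ := extract_Sm
    (g1 := fun n x => g1 n x + f3 n x + l * f5 n x) (g5 := fun n x => g5 n x - l * f1 n x)
    hL.le hk1 hrho1 hk2 hrho2 hk3 hrho1
    (fun n => ((cg1 n).add (k3 n)).add (continuousOn_const.mul (k5 n))) rf2 cg3 rf4
    (fun n => (cg5 n).sub (continuousOn_const.mul (k1 n))) rf6 nF'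
  obtain ⟨r1, r2, r3, r4, r5, r6⟩ := core hrho1 hrho2 hk1 hk2 hk3 hl ha0 hbeta hbetaL hspeed hne
    hlam (S := S) (T := T) (V2 := V2) (V4 := V4) (V6 := V6) (fun n => rfl) (fun n => rfl)
    (fun n => rfl) (fun n => rfl) (fun n => rfl) c1 c3 c5 k1 k3 k5 dφ1 dψ1 dw1 dg1 dg3 dg5 dS dP
    (fun n x hx => by simpa only [if_pos hx.2] using dT n x (Or.inl hx))
    (fun n x hx => by
      simpa only [if_neg (not_lt.2 hx.1.le), Complex.ofReal_zero] using dT n x (Or.inr hx))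
    (fun n => by
      obtain ⟨a1, a2, a3, a4, a5, a6, a7, a8, a9⟩ := bc0 n
      exact ⟨a1, a3, a5, a7, a8, a9⟩)
    (fun n => by
      obtain ⟨a1, a2, a3, a4, a5, a6, a7, a8, a9⟩ := bcL n
      exact ⟨a1, a3, a5, a7, a8, a9⟩)
    bS bV2 bψ1 bV4 bT bV6 s1 s2 s3 s4 s5 s6
  exact sum_contra hL.le r1 r2 r3 r4 r5 r6 nU'
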